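/- arXiv:2006.02998 — 2 statements merged into one kernel-verified Lean document; each statement's English description precedes it below -/
import Mathlib

section
/- Let G be a finite connected simple graph, u a vertex of G, and K the union of the vertex sets of some (possibly zero, possibly all) connected components of G − N[u]. Then c(G − K) ≤ c(G) ≤ max{c(G − K), c(K) + 1}. In particular, if c(K) ≤ k − 1 for a positive integer k, then c(G) ≤ k if and only if c(G − K) ≤ k. -/
open SimpleGraph

/-- `CopsWinFrom G c r` : in the game of cops and robbers on `G` with the cops at
positions `c` and the robber at `r`, with the cops to move, the cops can guarantee
to catch the robber.  A piece may stay put or move along an edge on its turn;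
the robber is caught as soon as some cop occupies its vertex. -/
inductive CopsWinFrom {V : Type*} (G : SimpleGraph V) {k : ℕ} : (Fin k → V) → V → Prop
  | caught (c : Fin k → V) (r : V) (h : ∃ i, c i = r) : CopsWinFrom G c r
  | stepCatch (c : Fin k → V) (r : V) (c' : Fin k → V)
      (hmove : ∀ i, c' i = c i ∨ G.Adj (c i) (c' i)) (h : ∃ i, c' i = r) :
      CopsWinFrom G c r
  | step (c : Fin k → V) (r : V) (c' : Fin k → V)
      (hmove : ∀ i, c' i = c i ∨ G.Adj (c i) (c' i))
      (h : ∀ r' : V, (r' = r ∨ G.Adj r r') → CopsWinFrom G c' r') :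
      CopsWinFrom G c r

/-- `k` cops have a winning strategy on `G`: they can choose initial positions so that,
whatever initial vertex the robber picks, they catch the robber. -/
def CopsWin {V : Type*} (G : SimpleGraph V) (k : ℕ) : Prop :=
  ∃ c : Fin k → V, ∀ r : V, CopsWinFrom G c r

/-- The cop number of a connected graph: the least number of cops that can always
catch the robber. -/
noncomputable def copNumberConn {V : Type*} (G : SimpleGraph V) : ℕ :=
  sInf {k | CopsWin G k}

/-- The cop number of a (possibly disconnected) graph: the maximum of the cop numbers
of its connected components. -/
noncomputable def copNumber {V : Type*} (G : SimpleGraph V) : ℕ :=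
  sSup {n | ∃ C : G.ConnectedComponent, n = copNumberConn (G.induce C.supp)}

/-- The closed neighbourhood `N[v]` of a vertex. -/
def closedNbhd {V : Type*} (G : SimpleGraph V) (v : V) : Set V :=
  insert v (G.neighborSet v)

section CopsAndRobbers

variable {V W : Type*} {G : SimpleGraph V} {H : SimpleGraph W}

/-- Winning positions are preserved by a retraction, where `f` and `s` may contract edges. -/
theorem CopsWinFrom.retract {f : V → W} {s : W → V}
    (hf : ∀ x y, G.Adj x y → f y = f x ∨ H.Adj (f x) (f y))
    (hs : ∀ x y, H.Adj x y → s y = s x ∨ G.Adj (s x) (s y))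
    (hfs : ∀ x, f (s x) = x) {k : ℕ} {c : Fin k → V} {v : V} (h : CopsWinFrom G c v) :
    ∀ r, v = s r → CopsWinFrom H (f ∘ c) r := by
  have move {c c' : Fin k → V} (hm : ∀ i, c' i = c i ∨ G.Adj (c i) (c' i)) (i) :
      (f ∘ c') i = (f ∘ c) i ∨ H.Adj ((f ∘ c) i) ((f ∘ c') i) := by
    rcases hm i with h | h
    · exact Or.inl (congrArg f h)
    · exact hf _ _ h
  induction h with
  | caught c v h =>
    rintro r rfl
    obtain ⟨i, hi⟩ := h
    exact .caught _ _ ⟨i, by simp [hi, hfs]⟩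
  | stepCatch c v c' hm h =>
    rintro r rfl
    obtain ⟨i, hi⟩ := h
    exact .stepCatch _ _ (f ∘ c') (move hm) ⟨i, by simp [hi, hfs]⟩
  | step c v c' hm _ ih =>
    rintro r rfl
    refine .step _ _ (f ∘ c') (move hm) fun r' hr' ↦ ih (s r') ?_ r' rfl
    rcases hr' with rfl | hr'
    · exact Or.inl rfl
    · exact hs _ _ hr'

theorem CopsWin.retract {f : V → W} {s : W → V}
    (hf : ∀ x y, G.Adj x y → f y = f x ∨ H.Adj (f x) (f y))
    (hs : ∀ x y, H.Adj x y → s y = s x ∨ G.Adj (s x) (s y))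
    (hfs : ∀ x, f (s x) = x) {k : ℕ} (h : CopsWin G k) : CopsWin H k := by
  obtain ⟨c, hc⟩ := h
  exact ⟨f ∘ c, fun r ↦ (hc (s r)).retract hf hs hfs r rfl⟩

theorem CopsWin.of_iso (e : G ≃g H) {k : ℕ} (h : CopsWin G k) : CopsWin H k :=
  h.retract (f := e) (s := e.symm) (fun _ _ h ↦ Or.inr (e.map_adj_iff.2 h))
    (fun _ _ h ↦ Or.inr (e.symm.map_adj_iff.2 h)) e.apply_symm_apply

theorem CopsWinFrom.of_comp_injective {k m : ℕ} {e : Fin k → Fin m} (he : e.Injective)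
    {d : Fin k → V} {r : V} (h : CopsWinFrom G d r) :
    ∀ c : Fin m → V, c ∘ e = d → CopsWinFrom G c r := by
  have move {c : Fin m → V} {d' : Fin k → V}
      (hm : ∀ i, d' i = (c ∘ e) i ∨ G.Adj ((c ∘ e) i) (d' i)) (i) :
      Function.extend e d' c i = c i ∨ G.Adj (c i) (Function.extend e d' c i) := by
    by_cases hi : ∃ j, e j = i
    · obtain ⟨j, rfl⟩ := hi
      simpa [he.extend_apply] using hm j
    · exact Or.inl (Function.extend_apply' _ _ _ hi)
  induction h with
  | caught d r h =>
    rintro c rfl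
    obtain ⟨i, hi⟩ := h
    exact .caught _ _ ⟨e i, hi⟩
  | stepCatch d r d' hm h =>
    rintro c rfl
    obtain ⟨i, hi⟩ := h
    exact .stepCatch _ _ _ (move hm) ⟨e i, by simp [he.extend_apply, hi]⟩
  | step d r d' hm _ ih =>
    rintro c rfl
    refine .step _ _ _ (move hm) fun r' hr' ↦ ih r' hr' _ ?_
    ext i
    simp [he.extend_apply]

theorem CopsWin.mono [Nonempty V] {k m : ℕ} (hkm : k ≤ m) (h : CopsWin G k) : CopsWin G m := by
  obtain ⟨c, hc⟩ := h
  have he := Fin.castLE_injective hkm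
  refine ⟨Function.extend (Fin.castLE hkm) c fun _ ↦ Classical.arbitrary V,
    fun r ↦ (hc r).of_comp_injective he _ ?_⟩
  ext i
  simp [he.extend_apply]

variable (G) in
theorem CopsWin.card [Finite V] : CopsWin G (Nat.card V) :=
  ⟨(Finite.equivFin V).symm, fun r ↦ .caught _ _ ⟨Finite.equivFin V r, by simp⟩⟩

theorem copNumberConn_le_iff [Finite V] [Nonempty V] {k : ℕ} :
    copNumberConn G ≤ k ↔ CopsWin G k :=
  ⟨fun h ↦ CopsWin.mono h (Nat.sInf_mem (s := {k | CopsWin G k}) ⟨_, CopsWin.card G⟩),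
    fun h ↦ Nat.sInf_le h⟩

theorem copNumber_le_iff [Finite V] {k : ℕ} :
    copNumber G ≤ k ↔ ∀ C : G.ConnectedComponent, CopsWin (G.induce C.supp) k := by
  have (C : G.ConnectedComponent) : Nonempty C.supp := C.nonempty_supp.to_subtype
  have hbdd : BddAbove {n | ∃ C : G.ConnectedComponent, n = copNumberConn (G.induce C.supp)} := by
    refine Set.Finite.bddAbove ((Set.finite_range
      fun C : G.ConnectedComponent ↦ copNumberConn (G.induce C.supp)).subset ?_)
    rintro _ ⟨C, rfl⟩
    exact ⟨C, rfl⟩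
  refine ⟨fun h C ↦ copNumberConn_le_iff.1 ((le_csSup hbdd ⟨C, rfl⟩).trans h), fun h ↦ ?_⟩
  refine csSup_le' ?_
  rintro _ ⟨C, rfl⟩
  exact copNumberConn_le_iff.2 (h C)

theorem SimpleGraph.Connected.copNumber_le_iff [Finite V] (hG : G.Connected) {k : ℕ} :
    copNumber G ≤ k ↔ CopsWin G k := by
  have e (C : G.ConnectedComponent) : G.induce C.supp ≃g G :=
    { toEquiv := Equiv.subtypeUnivEquiv fun v ↦ by
        obtain ⟨w, rfl⟩ := C.exists_rep
        exact ConnectedComponent.sound (hG.preconnected v w)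
      map_rel_iff' := Iff.rfl }
  obtain ⟨v⟩ := hG.nonempty
  rw [_root_.copNumber_le_iff]
  exact ⟨fun h ↦ (h (G.connectedComponentMk v)).of_iso (e _), fun h C ↦ h.of_iso (e C).symm⟩

/-- A cop adjacent to the robber captures it. -/
theorem CopsWinFrom.of_adj {k : ℕ} {c : Fin k → V} {r : V} {i : Fin k} (h : G.Adj (c i) r) :
    CopsWinFrom G c r := by
  refine .stepCatch _ _ (Function.update c i r) (fun j ↦ ?_) ⟨i, by simp⟩
  obtain rfl | hj := eq_or_ne j i
  · simp [h]
  · simp [hj]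

/-- One step of a shortest path. -/
theorem SimpleGraph.Connected.exists_dist_le_of_dist_le_succ (hG : G.Connected) {a b : V} {n : ℕ}
    (h : G.dist a b ≤ n + 1) :
    ∃ a', (a' = a ∨ G.Adj a a') ∧ (a = b → a' = b) ∧ G.dist a' b ≤ n := by
  obtain ⟨p, hp⟩ := hG.exists_walk_length_eq_dist a b
  cases p with
  | nil => exact ⟨a, Or.inl rfl, id, by simp⟩
  | @cons _ a' _ ha q =>
    refine ⟨a', Or.inr ha, ?_, ?_⟩
    · rintro rfl
      simp at hp
    · have := dist_le q
      rw [Walk.length_cons] at hp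
      omega

/-- The part `s` of `G` can be left only through neighbours of `u`. With one cop guarding `u`, a
winning strategy on `H` for the other cops is also one on `G`. -/
theorem CopsWinFrom.insertNth_guard {u : V} {s : W → V}
    (hs : ∀ x y, H.Adj x y → G.Adj (s x) (s y))
    (hexit : ∀ w v, G.Adj (s w) v → (∃ w', s w' = v ∧ H.Adj w w') ∨ G.Adj u v)
    {j : ℕ} {d : Fin j → W} {w : W} (h : CopsWinFrom H d w) (i₀ : Fin (j + 1)) :
    CopsWinFrom G (i₀.insertNth u (s ∘ d) : Fin (j + 1) → V) (s w) := by
  have move {d d' : Fin j → W} (hm : ∀ i, d' i = d i ∨ H.Adj (d i) (d' i)) (i) :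
      (i₀.insertNth u (s ∘ d') : Fin (j + 1) → V) i =
        (i₀.insertNth u (s ∘ d) : Fin (j + 1) → V) i ∨
      G.Adj ((i₀.insertNth u (s ∘ d) : Fin (j + 1) → V) i)
        ((i₀.insertNth u (s ∘ d') : Fin (j + 1) → V) i) := by
    refine Fin.succAboveCases i₀ ?_ (fun i ↦ ?_) i
    · simp
    · simp only [Fin.insertNth_apply_succAbove, Function.comp_apply]
      exact (hm i).imp (congrArg s) (hs _ _)
  induction h with
  | caught d w h =>
    obtain ⟨i, hi⟩ := h
    exact .caught _ _ ⟨i₀.succAbove i, by simp [hi]⟩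
  | stepCatch d w d' hm h =>
    obtain ⟨i, hi⟩ := h
    exact .stepCatch _ _ _ (move hm) ⟨i₀.succAbove i, by simp [hi]⟩
  | step d w d' hm _ ih =>
    refine .step _ _ _ (move hm) fun v hv ↦ ?_
    rcases hv with rfl | hv
    · exact ih w (Or.inl rfl)
    · rcases hexit w v hv with ⟨w', rfl, hw'⟩ | hu
      · exact ih w' (Or.inr hw')
      · exact .of_adj (i := i₀) (by simpa using hu)

/-- While a cop guards `u`, the other cops can walk to the initial positions of a winning strategy
on the part `s` of `G` in which the robber is confined. -/
theorem CopsWin.copsWinFrom_of_guard (hG : G.Connected) {u : V} {s : W → V}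
    (hs : ∀ x y, H.Adj x y → G.Adj (s x) (s y))
    (hexit : ∀ w v, G.Adj (s w) v → (∃ w', s w' = v ∧ H.Adj w w') ∨ G.Adj u v)
    {j : ℕ} (h : CopsWin H j) {c : Fin (j + 1) → V} {i₀ : Fin (j + 1)} (hc : c i₀ = u) (w : W) :
    CopsWinFrom G c (s w) := by
  obtain ⟨d, hd⟩ := h
  set t : Fin (j + 1) → V := i₀.insertNth u (s ∘ d) with ht
  have hti : t i₀ = u := by simp [ht]
  have key (n : ℕ) : ∀ c : Fin (j + 1) → V, c i₀ = u → (∀ i, G.dist (c i) (t i) ≤ n) →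
      ∀ w, CopsWinFrom G c (s w) := by
    induction n with
    | zero =>
      intro c _ hdist w
      have : c = t := funext fun i ↦ hG.dist_eq_zero_iff.1 (Nat.le_zero.1 (hdist i))
      exact this ▸ (hd w).insertNth_guard hs hexit i₀
    | succ n ih =>
      intro c hc hdist w
      choose c' hm hfix hdist' using fun i ↦ hG.exists_dist_le_of_dist_le_succ (hdist i)
      have hc' : c' i₀ = u := (hfix i₀ (hc.trans hti.symm)).trans hti
      refine .step _ _ c' hm fun v hv ↦ ?_
      rcases hv with rfl | hv
      · exact ih c' hc' hdist' w
      · rcases hexit w v hv with ⟨w', rfl, -⟩ | hu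
        · exact ih c' hc' hdist' w'
        · exact .of_adj (i := i₀) (hc' ▸ hu)
  exact key (Finset.univ.sup fun i ↦ G.dist (c i) (t i)) c hc
    (fun i ↦ Finset.le_sup (f := fun i ↦ G.dist (c i) (t i)) (Finset.mem_univ i)) w

/-- If the cops catch the shadow `f r` of the robber in `H`, and every position that the robber can
reach in one move once its shadow is caught is winning for the cops, then they win on `G`. -/
theorem CopsWinFrom.of_shadow {f : V → W} {s : W → V}
    (hf : ∀ x y, G.Adj x y → f y = f x ∨ H.Adj (f x) (f y))
    (hs : ∀ x y, H.Adj x y → G.Adj (s x) (s y)) {k : ℕ}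
    (hwin : ∀ (c : Fin k → V) (i : Fin k) (r r' : V), c i = s (f r) → (r' = r ∨ G.Adj r r') →
      CopsWinFrom G c r')
    {c : Fin k → W} {w : W} (h : CopsWinFrom H c w) :
    ∀ r, f r = w → CopsWinFrom G (s ∘ c) r := by
  have move {c c' : Fin k → W} (hm : ∀ i, c' i = c i ∨ H.Adj (c i) (c' i)) (i) :
      (s ∘ c') i = (s ∘ c) i ∨ G.Adj ((s ∘ c) i) ((s ∘ c') i) :=
    (hm i).imp (congrArg s) (hs _ _)
  induction h with
  | caught c w h =>
    rintro r rfl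
    obtain ⟨i, hi⟩ := h
    exact hwin _ i r r (congrArg s hi) (Or.inl rfl)
  | stepCatch c w c' hm h =>
    rintro r rfl
    obtain ⟨i, hi⟩ := h
    exact .step _ _ _ (move hm) fun r' hr' ↦ hwin _ i r r' (congrArg s hi) hr'
  | step c w c' hm _ ih =>
    rintro r rfl
    refine .step _ _ _ (move hm) fun r' hr' ↦ ih (f r') ?_ r' rfl
    rcases hr' with rfl | hr'
    · exact Or.inl rfl
    · exact hf _ _ hr'

theorem SimpleGraph.Connected.of_surjective_of_adj (hG : G.Connected) {f : V → W}
    (hsurj : f.Surjective) (hf : ∀ x y, G.Adj x y → f y = f x ∨ H.Adj (f x) (f y)) :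
    H.Connected := by
  have : Nonempty W := hG.nonempty.map f
  refine ⟨fun a b ↦ ?_⟩
  obtain ⟨x, rfl⟩ := hsurj a
  obtain ⟨y, rfl⟩ := hsurj b
  obtain ⟨p⟩ := hG.preconnected x y
  induction p with
  | nil => rfl
  | cons h _ ih =>
    refine Reachable.trans ?_ ih
    rcases hf _ _ h with h | h
    · rw [h]
    · exact h.reachable

end CopsAndRobbers

/-- If `G` is a finite connected graph, `u` a vertex and `K` a union of
(vertex sets of) connected components of `G - N[u]`, then
`c(G - K) ≤ c(G) ≤ max (c(G - K)) (c(K) + 1)`; in particular, for a positive integer `k`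
with `c(K) ≤ k - 1`, `c(G) ≤ k` iff `c(G - K) ≤ k`. -/
theorem retract_components {V : Type*} [Fintype V] (G : SimpleGraph V) (hG : G.Connected)
    (u : V) (K : Set V) (hK : K ⊆ (closedNbhd G u)ᶜ)
    (hcomp : ∀ x y : ((closedNbhd G u)ᶜ : Set V),
      (G.induce ((closedNbhd G u)ᶜ)).Reachable x y → ((x : V) ∈ K ↔ (y : V) ∈ K)) :
    copNumber (G.induce Kᶜ) ≤ copNumber G ∧
    copNumber G ≤ max (copNumber (G.induce Kᶜ)) (copNumber (G.induce K) + 1) ∧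
    ∀ k : ℕ, 0 < k → copNumber (G.induce K) ≤ k - 1 →
      (copNumber G ≤ k ↔ copNumber (G.induce Kᶜ) ≤ k) := by
  classical
  have huK : u ∉ K := fun h ↦ hK h (Set.mem_insert _ _)
  have hexit {x y : V} (hx : x ∈ K) (hy : y ∉ K) (hxy : G.Adj x y) : G.Adj u y := by
    by_contra huy
    have hyu : y ≠ u := by
      rintro rfl
      exact hK hx (Or.inr hxy.symm)
    have hyN : y ∈ (closedNbhd G u)ᶜ := fun h ↦ h.elim hyu huy
    have hr : (G.induce (closedNbhd G u)ᶜ).Adj ⟨x, hK hx⟩ ⟨y, hyN⟩ := hxy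
    exact hy ((hcomp _ _ hr.reachable).1 hx)
  let f : V → (Kᶜ : Set V) := fun v ↦ if h : v ∈ K then ⟨u, huK⟩ else ⟨v, h⟩
  have fK {v : V} (h : v ∈ K) : f v = ⟨u, huK⟩ := dif_pos h
  have fnK {v : V} (h : v ∉ K) : f v = ⟨v, h⟩ := dif_neg h
  have hf (x y : V) (hxy : G.Adj x y) : f y = f x ∨ (G.induce Kᶜ).Adj (f x) (f y) := by
    by_cases hx : x ∈ K <;> by_cases hy : y ∈ K
    · exact Or.inl ((fK hy).trans (fK hx).symm)
    · rw [fK hx, fnK hy]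
      exact Or.inr (hexit hx hy hxy)
    · rw [fnK hx, fK hy]
      exact Or.inr (hexit hy hx hxy.symm).symm
    · rw [fnK hx, fnK hy]
      exact Or.inr hxy
  have hfs (x : (Kᶜ : Set V)) : f x = x := fnK x.2
  have hconn : (G.induce Kᶜ).Connected := hG.of_surjective_of_adj (fun x ↦ ⟨x, hfs x⟩) hf
  have hlower : copNumber (G.induce Kᶜ) ≤ copNumber G :=
    hconn.copNumber_le_iff.2
      ((hG.copNumber_le_iff.1 le_rfl).retract (s := Subtype.val) hf (fun _ _ ↦ Or.inr) hfs)
  have hupper : copNumber G ≤ max (copNumber (G.induce Kᶜ)) (copNumber (G.induce K) + 1) := by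
    obtain ⟨j, hj⟩ : ∃ j, max (copNumber (G.induce Kᶜ)) (copNumber (G.induce K) + 1) = j + 1 :=
      Nat.exists_eq_add_of_le' (le_max_of_le_right (Nat.le_add_left 1 _))
    rw [hj]
    have hjK : copNumber (G.induce K) ≤ j := by omega
    obtain ⟨c, hc⟩ := hconn.copNumber_le_iff.1 ((le_max_left _ _).trans hj.le)
    have hguard (c : Fin (j + 1) → V) (i : Fin (j + 1)) (hi : c i = u) (r : V) (hr : r ∈ K) :
        CopsWinFrom G c r := by
      let C := (G.induce K).connectedComponentMk ⟨r, hr⟩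
      refine (copNumber_le_iff.1 hjK C).copsWinFrom_of_guard hG (s := fun w : C.supp ↦ (w : V))
        (fun _ _ h ↦ h) (fun w v hv ↦ ?_) hi ⟨⟨r, hr⟩, rfl⟩
      by_cases hvK : v ∈ K
      · have hadj : (G.induce K).Adj w.1 ⟨v, hvK⟩ := hv
        exact Or.inl ⟨⟨⟨v, hvK⟩, C.mem_supp_of_adj_mem_supp w.2 hadj⟩, rfl, hv⟩
      · exact Or.inr (hexit w.1.2 hvK hv)
    refine hG.copNumber_le_iff.2 ⟨Subtype.val ∘ c, fun r ↦
      (hc (f r)).of_shadow hf (fun _ _ h ↦ h) (fun c i r r' hi hr' ↦ ?_) r rfl⟩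
    by_cases hr : r ∈ K
    · rw [fK hr] at hi
      by_cases hrK : r' ∈ K
      · exact hguard c i hi r' hrK
      · rcases hr' with rfl | hr'
        · exact absurd hr hrK
        · exact .of_adj (i := i) (hi ▸ hexit hr hrK hr')
    · rw [fnK hr] at hi
      rcases hr' with rfl | hr'
      · exact .caught _ _ ⟨i, hi⟩
      · exact .of_adj (i := i) (hi ▸ hr')
  refine ⟨hlower, hupper, fun k hk hKk ↦ ⟨hlower.trans, fun h ↦ hupper.trans (max_le h ?_)⟩⟩
  omega
end

section
/- If G is a finite connected simple graph on at most 20 vertices with maximum degree Δ ≤ 3, then c(G) ≤ 3. -/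
open SimpleGraph

universe u

theorem SimpleGraph.Connected.exists_adj_dist_add_one {V : Type*} {G : SimpleGraph V}
    (hG : G.Connected) {u v : V} (h : u ≠ v) : ∃ w, G.Adj u w ∧ G.dist w v + 1 = G.dist u v := by
  obtain ⟨q, hq⟩ := hG.exists_walk_length_eq_dist u v
  cases q with
  | nil => exact absurd rfl h
  | @cons _ w _ hw q =>
    refine ⟨w, hw, ?_⟩
    have h1 := dist_le q
    have h2 := hG.dist_triangle (u := u) (v := w) (w := v)
    rw [dist_eq_one_iff_adj.2 hw] at h2
    simp only [Walk.length_cons] at hq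
    omega

/-! ### Transferring strategies along retractions -/

theorem copsWin_of_subsingleton {V : Type*} [Subsingleton V] [Nonempty V] (G : SimpleGraph V)
    (k : ℕ) : CopsWin G (k + 1) :=
  ⟨fun _ => Classical.arbitrary V, fun _ => .caught _ _ ⟨0, Subsingleton.elim _ _⟩⟩

/-- `g` is a retraction of `G`, in the reflexive sense, onto the vertex set `S`. -/
structure IsRetraction {V : Type*} (G : SimpleGraph V) (S : Set V) (g : V → V) : Prop where
  mem : ∀ v, g v ∈ S
  fix : ∀ v ∈ S, g v = v
  adj : ∀ u v, G.Adj u v → g v = g u ∨ G.Adj (g u) (g v)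

namespace IsRetraction

variable {V : Type*} {G : SimpleGraph V} {S : Set V} {g : V → V}

theorem move (hg : IsRetraction G S g) {r r' : V} (h : r' = r ∨ G.Adj r r') :
    g r' = g r ∨ G.Adj (g r) (g r') := by
  rcases h with rfl | h
  · exact Or.inl rfl
  · exact hg.adj _ _ h

theorem connected (hg : IsRetraction G S g) (hG : G.Connected) : (G.induce S).Connected := by
  have key : ∀ u v, G.Reachable u v →
      (G.induce S).Reachable ⟨g u, hg.mem u⟩ ⟨g v, hg.mem v⟩ := by
    rintro u v ⟨p⟩
    induction p with
    | nil => exact Reachable.refl _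
    | cons h p ih =>
      rename_i a b c
      refine Reachable.trans ?_ ih
      rcases hg.adj _ _ h with h' | h'
      · simp only [h']; exact Reachable.refl _
      · exact Adj.reachable (G := G.induce S) h'
  obtain ⟨v₀⟩ := hG.nonempty
  have : Nonempty S := ⟨⟨g v₀, hg.mem v₀⟩⟩
  refine ⟨fun u v => ?_⟩
  have := key u v (hG.preconnected _ _)
  simpa [hg.fix _ u.2, hg.fix _ v.2] using this

/-- A strategy on the retract captures the image of the robber. -/
theorem copsWinFrom (hg : IsRetraction G S g) {k : ℕ}
    (hcatch : ∀ (c : Fin k → V) (r : V), (∃ i, g r = c i ∨ G.Adj (c i) (g r)) →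
      CopsWinFrom G c r)
    {c : Fin k → S} {s : S} (h : CopsWinFrom (G.induce S) c s) :
    ∀ r, g r = s → CopsWinFrom G (fun i => (c i : V)) r := by
  induction h with
  | caught c s h =>
    obtain ⟨i, rfl⟩ := h
    exact fun r hr => hcatch _ _ ⟨i, Or.inl hr⟩
  | stepCatch c s c' hmove h =>
    obtain ⟨i, rfl⟩ := h
    refine fun r hr => hcatch _ _ ⟨i, ?_⟩
    rcases hmove i with h | h
    · exact Or.inl (by rw [hr, h])
    · exact Or.inr (by rw [hr]; exact h)
  | step c s c' hmove h ih =>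
    intro r hr
    refine .step _ _ (fun i => (c' i : V)) (fun i => ?_) fun r' hr' => ?_
    · rcases hmove i with h | h
      · exact Or.inl (by rw [h])
      · exact Or.inr h
    · refine ih ⟨g r', hg.mem r'⟩ ?_ r' rfl
      rcases hg.move hr' with h | h
      · exact Or.inl (Subtype.ext (h.trans hr))
      · exact Or.inr (by rw [hr] at h; exact h)

theorem copsWin (hg : IsRetraction G S g) {k : ℕ}
    (hcatch : ∀ (c : Fin k → V) (r : V), (∃ i, g r = c i ∨ G.Adj (c i) (g r)) →
      CopsWinFrom G c r)
    (h : CopsWin (G.induce S) k) : CopsWin G k := by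
  obtain ⟨c, hc⟩ := h
  exact ⟨fun i => c i, fun r => hg.copsWinFrom hcatch (hc ⟨g r, hg.mem r⟩) r rfl⟩

end IsRetraction

/-- Removing a pendant vertex does not matter to the cops. -/
theorem copsWin_of_pendant {V : Type*} {G : SimpleGraph V} {x : V} {g : V → V}
    (hg : IsRetraction G {x}ᶜ g) (hx : G.Adj (g x) x) (hN : ∀ z, G.Adj x z → z = g x) {k : ℕ}
    (h : CopsWin (G.induce {x}ᶜ) k) : CopsWin G k := by
  refine hg.copsWin (fun c r ⟨i, hi⟩ => ?_) h
  classical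
  refine .step _ _ (Function.update c i (g r)) (fun j => ?_) fun r' hr' => ?_
  · by_cases hj : j = i
    · subst hj; simpa using hi
    · simp [hj]
  · by_cases hrx : r = x
    · subst hrx
      rcases hr' with rfl | hr'
      · refine .stepCatch _ _ (Function.update c i r') (fun j => ?_) ⟨i, by simp⟩
        by_cases hj : j = i
        · subst hj; simpa using Or.inr hx
        · simp [hj]
      · exact .caught _ _ ⟨i, by simp [hN _ hr']⟩
    · have hr : g r = r := hg.fix _ hrx
      by_cases hrx' : r' = x
      · subst hrx'
        rcases hr' with rfl | hr'
        · exact absurd rfl hrx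
        · refine .stepCatch _ _ (Function.update c i r') (fun j => ?_) ⟨i, by simp⟩
          by_cases hj : j = i
          · subst hj; simpa [hr] using Or.inr hr'
          · simp [hj]
      · refine .stepCatch _ _ (Function.update c i r') (fun j => ?_) ⟨i, by simp⟩
        by_cases hj : j = i
        · subst hj; simpa [hr] using hr'
        · simp [hj]

section Guard

variable {V : Type*} {G : SimpleGraph V} {B : Set V} {g : V → V}

/-- While one cop shadows the robber's image, the others play a winning strategy inside `B`. -/
theorem IsRetraction.copsWinFrom_insertNth (hg : IsRetraction G Bᶜ g) {k : ℕ} (i : Fin (k + 1))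
    {c : Fin k → B} {r : B} (h : CopsWinFrom (G.induce B) c r) :
    ∀ p, (g r = p ∨ G.Adj p (g r)) →
      CopsWinFrom G (i.insertNth p (fun j => (c j : V)) : Fin (k + 1) → V) r := by
  induction h with
  | caught c r h =>
    obtain ⟨j, rfl⟩ := h
    exact fun p _ => .caught _ _ ⟨i.succAbove j, by simp⟩
  | stepCatch c r c' hmove h =>
    obtain ⟨j, rfl⟩ := h
    refine fun p _ => .stepCatch _ _ (i.insertNth p (fun j => (c' j : V)) : Fin (k + 1) → V)
      (fun l => ?_) ⟨i.succAbove j, by simp⟩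
    refine Fin.succAboveCases i (by simp) (fun l => ?_) l
    rcases hmove l with h | h
    · simp [h]
    · exact Or.inr (by simpa using h)
  | step c r c' hmove h ih =>
    intro p hp
    refine .step _ _ (i.insertNth (g r) (fun j => (c' j : V)) : Fin (k + 1) → V)
      (fun l => ?_) fun r' hr' => ?_
    · refine Fin.succAboveCases i (by simpa using hp) (fun l => ?_) l
      rcases hmove l with h | h
      · simp [h]
      · exact Or.inr (by simpa using h)
    · by_cases hB : r' ∈ B
      · refine ih ⟨r', hB⟩ ?_ _ (hg.move hr')
        rcases hr' with h | h
        · exact Or.inl (Subtype.ext h)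
        · exact Or.inr h
      · have hfix : g r' = r' := hg.fix _ hB
        have := hg.move hr'
        rw [hfix] at this
        refine .stepCatch _ _ (i.insertNth r' (fun j => (c' j : V)) : Fin (k + 1) → V)
          (fun l => ?_) ⟨i, by simp⟩
        exact Fin.succAboveCases i (by simpa using this) (fun l => by simp) l

/-- While one cop shadows the robber's image, the others can walk to any prescribed positions. -/
theorem IsRetraction.copsWinFrom_travel (hg : IsRetraction G Bᶜ g) (hG : G.Connected) {k : ℕ}
    (i : Fin (k + 1)) {t : Fin k → B} (ht : ∀ r : B, CopsWinFrom (G.induce B) t r) (n : ℕ) :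
    ∀ (c : Fin k → V) (p r : V), (∀ j, G.dist (c j) (t j) ≤ n) →
      (g r = p ∨ G.Adj p (g r)) → CopsWinFrom G (i.insertNth p c : Fin (k + 1) → V) r := by
  induction n with
  | zero =>
    intro c p r hc hp
    have hct : c = fun j => (t j : V) := by
      funext j
      exact hG.dist_eq_zero_iff.1 (Nat.le_zero.1 (hc j))
    subst hct
    by_cases hB : r ∈ B
    · exact hg.copsWinFrom_insertNth i (ht ⟨r, hB⟩) p hp
    · rw [hg.fix _ hB] at hp
      refine .stepCatch _ _ (i.insertNth r (fun j => (t j : V)) : Fin (k + 1) → V)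
        (fun l => ?_) ⟨i, by simp⟩
      exact Fin.succAboveCases i (by simpa using hp) (fun l => by simp) l
  | succ n ih =>
    intro c p r hc hp
    have hmove : ∀ j, ∃ w, (w = c j ∨ G.Adj (c j) w) ∧ G.dist w (t j) ≤ n := by
      intro j
      by_cases h : c j = t j
      · exact ⟨c j, Or.inl rfl, by simp [h]⟩
      · obtain ⟨w, hw, hd⟩ := hG.exists_adj_dist_add_one h
        have := hc j
        exact ⟨w, Or.inr hw, by omega⟩
    choose c' hc' hd using hmove
    refine .step _ _ (i.insertNth (g r) c' : Fin (k + 1) → V) (fun l => ?_) fun r' hr' => ?_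
    · exact Fin.succAboveCases i (by simpa using hp) (fun l => by simpa using hc' l) l
    · exact ih _ _ _ hd (hg.move hr')

/-- One cop catches the robber's image in the retract `Bᶜ` and shadows it from then on, while the
others catch the robber in `B`. -/
theorem IsRetraction.copsWin_succ (hg : IsRetraction G Bᶜ g) (hG : G.Connected) {k : ℕ}
    (hS : CopsWin (G.induce Bᶜ) (k + 1)) (hB : CopsWin (G.induce B) k) :
    CopsWin G (k + 1) := by
  obtain ⟨t, ht⟩ := hB
  refine hg.copsWin (fun c r ⟨i, hi⟩ => ?_) hS
  obtain ⟨n, hn⟩ : ∃ n, ∀ j, G.dist (c (i.succAbove j)) (t j) ≤ n := by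
    obtain ⟨n, hn⟩ := (Set.finite_range fun j => G.dist (c (i.succAbove j)) (t j)).bddAbove
    exact ⟨n, fun j => hn ⟨j, rfl⟩⟩
  have := hg.copsWinFrom_travel hG i ht n (fun j => c (i.succAbove j)) (c i) r hn hi
  have e : (i.insertNth (c i) (fun j => c (i.succAbove j)) : Fin (k + 1) → V) = c :=
    Fin.insertNth_self_removeNth i c
  rwa [e] at this

end Guard

/-! ### The excess of a vertex set -/

open Classical in
/-- The sum of `deg v - 2` over the subgraph induced by `S`, that is, twice the difference between
its numbers of edges and vertices. -/
noncomputable def excess {V : Type*} (G : SimpleGraph V) (S : Finset V) : ℤ :=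
  ∑ v ∈ S, (∑ w ∈ S, (if G.Adj v w then 1 else 0) - 2)

section Excess

variable {V : Type*} {G : SimpleGraph V}

theorem excess_induce {A : Set V} (R : Finset A) :
    excess (G.induce A) R = excess G (R.map (Function.Embedding.subtype (· ∈ A))) := by
  simp only [excess, Finset.sum_map]
  rfl

theorem excess_induce_univ {S : Finset V} {A : Set V} [Fintype A] (hA : ∀ v, v ∈ S ↔ v ∈ A) :
    excess (G.induce A) Finset.univ = excess G S := by
  rw [excess_induce]
  congr 1
  ext v
  simp [hA]

open Classical in
theorem sum_adj_comm (S T : Finset V) :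
    (∑ v ∈ S, ∑ w ∈ T, (if G.Adj v w then 1 else 0) : ℤ) =
      ∑ v ∈ T, ∑ w ∈ S, (if G.Adj v w then 1 else 0) := by
  rw [Finset.sum_comm]
  simp only [G.adj_comm]

variable [Fintype V]

theorem sum_adj_eq_degree [DecidableRel G.Adj] (v : V) :
    (∑ w, (if G.Adj v w then 1 else 0) : ℤ) = G.degree v := by
  rw [Finset.sum_boole, ← card_neighborFinset_eq_degree, neighborFinset_eq_filter]

theorem excess_univ [DecidableRel G.Adj] :
    excess G Finset.univ = ∑ v, ((G.degree v : ℤ) - 2) := by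
  unfold excess
  refine Finset.sum_congr rfl fun v _ => ?_
  rw [← sum_adj_eq_degree]
  congr!

theorem excess_univ_eq_card_edgeFinset [DecidableRel G.Adj] :
    excess G Finset.univ = 2 * (G.edgeFinset.card - Fintype.card V : ℤ) := by
  rw [excess_univ, Finset.sum_sub_distrib]
  have := G.sum_degrees_eq_twice_card_edges
  rw [← Nat.cast_sum, this]
  simp
  ring

theorem even_excess_univ : Even (excess G Finset.univ) := by
  classical
  rw [excess_univ_eq_card_edgeFinset]
  exact even_two_mul _

theorem SimpleGraph.Connected.neg_two_le_excess (hG : G.Connected) :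
    -2 ≤ excess G Finset.univ := by
  classical
  have := hG.card_vert_le_card_edgeSet_add_one
  rw [excess_univ_eq_card_edgeFinset]
  rw [Nat.card_eq_fintype_card, Nat.card_eq_fintype_card, ← edgeFinset_card] at this
  omega

open Classical in
theorem sum_sum_adj_add_compl (S T : Finset V) :
    (∑ v ∈ S, ∑ w ∈ T, (if G.Adj v w then 1 else 0) : ℤ) +
      ∑ v ∈ S, ∑ w ∈ Tᶜ, (if G.Adj v w then 1 else 0) = ∑ v ∈ S, (G.degree v : ℤ) := by
  rw [← Finset.sum_add_distrib]
  refine Finset.sum_congr rfl fun v _ => ?_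
  rw [Finset.sum_add_sum_compl, sum_adj_eq_degree]

open Classical in
theorem excess_compl (S : Finset V) :
    excess G Sᶜ = excess G Finset.univ + excess G S - 2 * ∑ v ∈ S, ((G.degree v : ℤ) - 2) := by
  have h1 := sum_sum_adj_add_compl (G := G) S S
  have h2 := sum_sum_adj_add_compl (G := G) Sᶜ S
  have h3 := sum_adj_comm (G := G) S Sᶜ
  have h4 := Finset.sum_add_sum_compl S fun v => ((G.degree v : ℤ) - 2)
  have h5 : ∀ T : Finset V, excess G T =
      (∑ v ∈ T, ∑ w ∈ T, (if G.Adj v w then 1 else 0) : ℤ) - ∑ v ∈ T, 2 :=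
    fun T => Finset.sum_sub_distrib _ _
  rw [excess_univ, h5, h5]
  simp only [Finset.sum_sub_distrib] at h4 ⊢
  linarith

open Classical in
/-- Removing a connected piece from a connected graph does not increase the excess. -/
theorem excess_compl_le (hG : G.Connected) {S : Finset V} (hS : -2 ≤ excess G S)
    (hne : S.Nonempty) (hne' : Sᶜ.Nonempty) : excess G Sᶜ ≤ excess G Finset.univ := by
  obtain ⟨a, ha, b, hb, hab⟩ : ∃ a ∈ S, ∃ b ∈ Sᶜ, G.Adj a b := by
    obtain ⟨u, hu⟩ := hne
    obtain ⟨v, hv⟩ := hne'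
    obtain ⟨p⟩ := hG.preconnected u v
    obtain ⟨d, -, h1, h2⟩ := p.exists_boundary_dart (S : Set V) hu (by simpa using hv)
    exact ⟨_, h1, _, by simpa using h2, d.adj⟩
  have h1 : (1 : ℤ) ≤ ∑ v ∈ S, ∑ w ∈ Sᶜ, (if G.Adj v w then 1 else 0) := by
    have : (if G.Adj a b then 1 else 0 : ℤ) ≤ ∑ w ∈ Sᶜ, (if G.Adj a w then 1 else 0) :=
      Finset.single_le_sum (f := fun w => (if G.Adj a w then 1 else 0 : ℤ))
        (fun w _ => by positivity) hb
    rw [if_pos hab] at this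
    refine this.trans (Finset.single_le_sum
      (f := fun v => ∑ w ∈ Sᶜ, (if G.Adj v w then 1 else 0 : ℤ))
        (fun v _ => Finset.sum_nonneg fun w _ => by positivity) ha)
  have h2 := sum_sum_adj_add_compl (G := G) S S
  have h5 : excess G S =
      (∑ v ∈ S, ∑ w ∈ S, (if G.Adj v w then 1 else 0) : ℤ) - ∑ v ∈ S, 2 :=
    Finset.sum_sub_distrib _ _
  rw [excess_compl, Finset.sum_sub_distrib]
  linarith

end Excess

/-! ### Guardable trees -/

theorem excess_le_neg_two_of_parent {V : Type*} {G : SimpleGraph V} {T : Finset V} {y : V}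
    (hy : y ∈ T) (p : V → V)
    (hp : ∀ u ∈ T, ∀ v ∈ T, G.Adj u v → (u ≠ y ∧ p u = v) ∨ (v ≠ y ∧ p v = u)) :
    excess G T ≤ -2 := by
  classical
  have h1 : (∑ u ∈ T, ∑ v ∈ T, (if G.Adj u v then 1 else 0) : ℤ) ≤
      ∑ u ∈ T, ∑ v ∈ T, ((if u ≠ y ∧ p u = v then 1 else 0) +
        (if v ≠ y ∧ p v = u then 1 else 0)) := by
    refine Finset.sum_le_sum fun u hu => Finset.sum_le_sum fun v hv => ?_
    split_ifs with h h2 h3 h3 <;> first | simp; done | skip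
    rcases hp u hu v hv h with h | h <;> contradiction
  have h2 : ∀ u ∈ T, (∑ v ∈ T, (if u ≠ y ∧ p u = v then 1 else 0) : ℤ) ≤
      if u ≠ y then 1 else 0 := by
    intro u _
    by_cases hu : u = y
    · simp [hu]
    · simp only [ne_eq, hu, not_false_eq_true, true_and, Finset.sum_ite_eq, if_true]
      split_ifs <;> simp
  have h3 : (∑ u ∈ T, (if u ≠ y then 1 else 0) : ℤ) = T.card - 1 := by
    have := Finset.card_filter_add_card_filter_not (s := T) (fun u => u = y)
    rw [Finset.filter_eq' T y, if_pos hy, Finset.card_singleton] at this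
    rw [Finset.sum_boole, ← this]
    push_cast
    ring
  have h4 := Finset.sum_le_sum h2
  have h5 : excess G T = (∑ v ∈ T, ∑ w ∈ T, (if G.Adj v w then 1 else 0) : ℤ) - ∑ v ∈ T, 2 :=
    Finset.sum_sub_distrib _ _
  simp only [Finset.sum_add_distrib] at h1
  rw [Finset.sum_comm (f := fun u v => (if v ≠ y ∧ p v = u then 1 else 0 : ℤ))] at h1
  rw [h5, Finset.sum_const, nsmul_eq_mul]
  linarith

/-- A nonempty set of vertices inducing a tree or a forest onto which the graph retracts. -/
structure Guardable {V : Type*} (G : SimpleGraph V) (T : Finset V) : Prop where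
  nonempty : T.Nonempty
  excess_le : excess G T ≤ -2
  exists_retraction : ∃ f, IsRetraction G (T : Set V) f

/-- A union of geodesics issuing from `y` whose ends are joined by geodesics through `y` is
guardable; each geodesic may be taken through a prescribed vertex. -/
theorem exists_guardable_spider {V : Type*} [Fintype V] {G : SimpleGraph V} (hG : G.Connected)
    {ι : Type*} (y : V) (w q : ι → V)
    (hq : ∀ i, G.dist y (q i) + G.dist (q i) (w i) = G.dist y (w i))
    (hw : ∀ i j, i ≠ j → G.dist (w i) (w j) = G.dist y (w i) + G.dist y (w j)) :
    ∃ T, Guardable G T ∧ y ∈ T ∧ ∀ i, w i ∈ T ∧ q i ∈ T := by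
  classical
  have hP : ∀ i, ∃ P : ℕ → V, P 0 = y ∧ P (G.dist y (q i)) = q i ∧ P (G.dist y (w i)) = w i ∧
      ∀ t < G.dist y (w i), G.Adj (P t) (P (t + 1)) := by
    intro i
    obtain ⟨p, hp⟩ := hG.exists_walk_length_eq_dist y (q i)
    obtain ⟨p', hp'⟩ := hG.exists_walk_length_eq_dist (q i) (w i)
    have hl : (p.append p').length = G.dist y (w i) := by rw [Walk.length_append, hp, hp', hq]
    refine ⟨(p.append p').getVert, Walk.getVert_zero _, ?_, ?_, fun t ht => ?_⟩
    · rw [← hp, Walk.getVert_append]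
      simp
    · rw [← hl, Walk.getVert_length]
    · exact Walk.adj_getVert_succ _ (hl ▸ ht)
  choose P hP0 hPq hPw hPadj using hP
  have hstep : ∀ i s t, s ≤ t → t ≤ G.dist y (w i) → G.dist (P i s) (P i t) ≤ t - s := by
    intro i s t hst
    induction t, hst using Nat.le_induction with
    | base => simp
    | succ t hst ih =>
      intro ht
      have h1 := hG.dist_triangle (u := P i s) (v := P i t) (w := P i (t + 1))
      have h2 := dist_eq_one_iff_adj.2 (hPadj i t ht)
      have := ih (by omega)
      omega
  have hy : ∀ i t, t ≤ G.dist y (w i) → G.dist y (P i t) = t ∧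
      G.dist (P i t) (w i) = G.dist y (w i) - t := by
    intro i t ht
    have h1 := hstep i 0 t (by omega) ht
    have h2 := hstep i t _ ht le_rfl
    rw [hP0] at h1
    rw [hPw] at h2
    have h3 := hG.dist_triangle (u := y) (v := P i t) (w := w i)
    omega
  have hsame : ∀ i s t, s ≤ t → t ≤ G.dist y (w i) → G.dist (P i s) (P i t) = t - s := by
    intro i s t hst ht
    have h1 := hstep i s t hst ht
    have h2 := hG.dist_triangle (u := y) (v := P i s) (w := P i t)
    have h3 := (hy i s (by omega)).1
    have h4 := (hy i t ht).1
    omega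
  have hdiff : ∀ i j s t, i ≠ j → s ≤ G.dist y (w i) → t ≤ G.dist y (w j) →
      G.dist (P i s) (P j t) = s + t := by
    intro i j s t hij hs ht
    have h1 := hG.dist_triangle (u := w i) (v := P i s) (w := w j)
    have h2 := hG.dist_triangle (u := P i s) (v := P j t) (w := w j)
    have h3 := hG.dist_triangle (u := P i s) (v := y) (w := P j t)
    have h4 := hy i s hs
    have h5 := hy j t ht
    have h6 := hw i j hij
    rw [SimpleGraph.dist_comm (u := w i) (v := P i s)] at h1
    rw [SimpleGraph.dist_comm (u := P i s) (v := y)] at h3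
    omega
  have hinj : ∀ i j s t, s < G.dist y (w i) → t < G.dist y (w j) → P i (s + 1) = P j (t + 1) →
      i = j ∧ s = t := by
    intro i j s t hs ht h
    have h1 := (hy i (s + 1) hs).1
    have h2 := (hy j (t + 1) ht).1
    rw [h] at h1
    refine ⟨by_contra fun hij => ?_, by omega⟩
    have := hdiff i j (s + 1) (t + 1) hij hs ht
    rw [h, SimpleGraph.dist_self] at this
    omega
  obtain ⟨T, hT⟩ : ∃ T : Finset V, ∀ v, v ∈ T ↔ v = y ∨ ∃ i, ∃ t < G.dist y (w i),
      v = P i (t + 1) := 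
    ⟨Finset.univ.filter fun v => v = y ∨ ∃ i, ∃ t < G.dist y (w i), v = P i (t + 1),
      fun v => by simp⟩
  have hmem : ∀ i t, t ≤ G.dist y (w i) → P i t ∈ T := by
    intro i t ht
    rw [hT]
    rcases t with _ | t
    · exact Or.inl (hP0 i)
    · exact Or.inr ⟨i, t, ht, rfl⟩
  have hyT : y ∈ T := (hT y).2 (Or.inl rfl)
  refine ⟨T, ⟨⟨y, hyT⟩, ?_, ?_⟩, hyT, fun i => ⟨?_, ?_⟩⟩
  · have hp : ∀ v, ∃ u, ∀ i, ∀ t < G.dist y (w i), v = P i (t + 1) → u = P i t := by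
      intro v
      by_cases hv : ∃ i, ∃ t < G.dist y (w i), v = P i (t + 1)
      · obtain ⟨i, t, ht, rfl⟩ := hv
        refine ⟨P i t, fun j s hs h => ?_⟩
        obtain ⟨rfl, rfl⟩ := hinj i j t s ht hs h
        rfl
      · push Not at hv
        exact ⟨y, fun i t ht h => absurd h (hv i t ht)⟩
    choose p hp using hp
    have hne : ∀ i, ∀ t < G.dist y (w i), P i (t + 1) ≠ y := by
      intro i t ht h
      have := (hy i (t + 1) ht).1
      rw [h, SimpleGraph.dist_self] at this
      omega
    refine excess_le_neg_two_of_parent hyT p fun u hu v hv huv => ?_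
    have hd := dist_eq_one_iff_adj.2 huv
    rcases (hT u).1 hu with rfl | ⟨i, s, hs, rfl⟩
    · rcases (hT v).1 hv with rfl | ⟨j, t, ht, rfl⟩
      · exact absurd rfl huv.ne
      · rw [(hy j (t + 1) ht).1] at hd
        obtain rfl : t = 0 := by omega
        exact Or.inr ⟨hne j 0 ht, by rw [hp _ j 0 ht rfl, hP0]⟩
    · rcases (hT v).1 hv with rfl | ⟨j, t, ht, rfl⟩
      · rw [SimpleGraph.dist_comm, (hy i (s + 1) hs).1] at hd
        obtain rfl : s = 0 := by omega
        exact Or.inl ⟨hne i 0 hs, by rw [hp _ i 0 hs rfl, hP0]⟩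
      · by_cases hij : i = j
        · subst hij
          rcases le_total s t with hst | hst
          · rw [hsame i (s + 1) (t + 1) (by omega) ht] at hd
            obtain rfl : t = s + 1 := by omega
            exact Or.inr ⟨hne i _ ht, hp _ i _ ht rfl⟩
          · rw [SimpleGraph.dist_comm, hsame i (t + 1) (s + 1) (by omega) hs] at hd
            obtain rfl : s = t + 1 := by omega
            exact Or.inl ⟨hne i _ hs, hp _ i _ hs rfl⟩
        · rw [hdiff i j (s + 1) (t + 1) hij hs ht] at hd
          omega
  · have hfar : ∀ x x' i j, G.dist x x' ≤ 1 → G.dist x (w i) < G.dist y (w i) →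
        G.dist x' (w j) < G.dist y (w j) → i = j := by
      intro x x' i j hx hi hj
      by_contra hij
      have h1 := hG.dist_triangle (u := w i) (v := x) (w := w j)
      have h2 := hG.dist_triangle (u := x) (v := x') (w := w j)
      have h3 := hw i j hij
      rw [SimpleGraph.dist_comm (u := w i) (v := x)] at h1
      omega
    have hf : ∀ x, ∃ z, (∀ i, G.dist x (w i) < G.dist y (w i) →
        z = P i (G.dist y (w i) - G.dist x (w i))) ∧
        ((∀ i, G.dist y (w i) ≤ G.dist x (w i)) → z = y) := by
      intro x
      by_cases hx : ∃ i, G.dist x (w i) < G.dist y (w i)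
      · obtain ⟨i, hi⟩ := hx
        refine ⟨P i (G.dist y (w i) - G.dist x (w i)), fun j hj => ?_,
          fun h => absurd hi (h i).not_gt⟩
        rw [hfar x x i j (by simp) hi hj]
      · push Not at hx
        exact ⟨y, fun i hi => absurd hi (hx i).not_gt, fun _ => rfl⟩
    choose f hf1 hf2 using hf
    refine ⟨f, fun v => ?_, fun v hv => ?_, fun u v huv => ?_⟩
    · by_cases hx : ∃ i, G.dist v (w i) < G.dist y (w i)
      · obtain ⟨i, hi⟩ := hx
        rw [hf1 v i hi]
        exact hmem i _ (by omega)
      · push Not at hx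
        rw [hf2 v hx]
        exact hyT
    · rcases (hT v).1 hv with rfl | ⟨i, t, ht, rfl⟩
      · exact hf2 v fun i => le_rfl
      · have := (hy i (t + 1) ht).2
        rw [hf1 _ i (by omega), this]
        congr 1
        omega
    · have hd := dist_eq_one_iff_adj.2 huv
      have hd' := dist_eq_one_iff_adj.2 huv.symm
      by_cases hu : ∃ i, G.dist u (w i) < G.dist y (w i)
      · obtain ⟨i, hi⟩ := hu
        have h1 := hG.dist_triangle (u := u) (v := v) (w := w i)
        have h2 := hG.dist_triangle (u := v) (v := u) (w := w i)
        rw [hf1 u i hi]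
        have h3 : f v = P i (G.dist y (w i) - G.dist v (w i)) := by
          by_cases hv : ∃ j, G.dist v (w j) < G.dist y (w j)
          · obtain ⟨j, hj⟩ := hv
            obtain rfl := hfar u v i j hd.le hi hj
            exact hf1 v i hj
          · push Not at hv
            rw [hf2 v hv, Nat.sub_eq_zero_of_le (hv i), hP0]
        rw [h3]
        generalize hs : G.dist y (w i) - G.dist u (w i) = s
        generalize ht : G.dist y (w i) - G.dist v (w i) = t
        have : t = s ∨ t = s + 1 ∨ s = t + 1 := by omega
        rcases this with rfl | rfl | rfl
        · exact Or.inl rfl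
        · exact Or.inr (hPadj i s (by omega))
        · exact Or.inr (hPadj i t (by omega)).symm
      · push Not at hu
        rw [hf2 u hu]
        by_cases hv : ∃ j, G.dist v (w j) < G.dist y (w j)
        · obtain ⟨j, hj⟩ := hv
          have h1 := hG.dist_triangle (u := u) (v := v) (w := w j)
          have h2 := hu j
          rw [hf1 v j hj, show G.dist y (w j) - G.dist v (w j) = 0 + 1 by omega]
          exact Or.inr (hP0 j ▸ hPadj j 0 (by omega))
        · push Not at hv
          exact Or.inl (hf2 v hv)
  · rw [← hPw i]
    exact hmem i _ le_rfl
  · rw [← hPq i]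
    exact hmem i _ (by have := hq i; omega)

section Reduction

theorem degree_induce_le {V : Type*} {G : SimpleGraph V} {S : Set V} (v : S)
    [Fintype ((G.induce S).neighborSet v)] [Fintype (G.neighborSet v)] :
    (G.induce S).degree v ≤ G.degree (v : V) := by
  rw [← card_neighborSet_eq_degree, ← card_neighborSet_eq_degree]
  refine Fintype.card_le_of_injective (fun w => ⟨w.1, w.2⟩) fun w w' h => ?_
  simpa [Subtype.ext_iff] using h

theorem excess_union {V : Type*} [DecidableEq V] {G : SimpleGraph V} {S T : Finset V}
    (hST : Disjoint S T) (h : ∀ u ∈ S, ∀ v ∈ T, ¬ G.Adj u v) :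
    excess G (S ∪ T) = excess G S + excess G T := by
  classical
  unfold excess
  rw [Finset.sum_union hST]
  congr 1 <;> refine Finset.sum_congr rfl fun u hu => ?_ <;> rw [Finset.sum_union hST]
  · rw [Finset.sum_eq_zero (s := T) fun v hv => if_neg (h u hu v hv), add_zero]
  · rw [Finset.sum_eq_zero (s := S) fun v hv => if_neg fun e => h v hv u hu e.symm, zero_add]

/-- Outside a guardable set there is a connected piece of small excess which the cops may be asked
to clear while a guard stays behind. -/
theorem Guardable.exists_piece {V : Type*} [Fintype V] [DecidableEq V] {G : SimpleGraph V}
    {T : Finset V} (hT : Guardable G T) {c : ℤ} (hc : -1 ≤ c) (hTc : Tᶜ.Nonempty)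
    (hc' : excess G Tᶜ ≤ c) :
    ∃ B : Finset V, Bᶜ.Nonempty ∧ (G.induce (B : Set V)).Connected ∧ excess G B ≤ c ∧
      ∃ g, IsRetraction G (B : Set V)ᶜ g := by
  classical
  obtain ⟨B, ⟨hBne, hBT, hBcl, hBc⟩, hmin⟩ := exists_minimal_of_wellFoundedLT
    (fun B : Finset V => B.Nonempty ∧ (∀ v ∈ B, v ∉ T) ∧
      (∀ v ∈ B, ∀ w, G.Adj v w → w ∈ B ∨ w ∈ T) ∧ excess G B ≤ c)
    ⟨Tᶜ, hTc, fun v hv => by simpa using hv,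
      fun v _ w _ => by simpa using (em (w ∈ T)).symm, hc'⟩
  obtain ⟨t, ht⟩ := hT.nonempty
  refine ⟨B, ⟨t, by simpa using fun h => hBT t h ht⟩, ?_, hBc, ?_⟩
  · rw [connected_iff]
    refine ⟨fun u => ?_, hBne.to_subtype⟩
    set B₁ := B.filter fun v => ∃ h : v ∈ B, (G.induce (B : Set V)).Reachable u ⟨v, h⟩ with hB₁
    have hsub : B₁ ⊆ B := Finset.filter_subset _ _
    have hno : ∀ v ∈ B₁, ∀ w ∈ B \ B₁, ¬ G.Adj v w := by
      intro v hv w hw hvw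
      simp only [hB₁, Finset.mem_sdiff, Finset.mem_filter, not_and, not_exists] at hv hw
      obtain ⟨hvB, _, hv⟩ := hv
      refine hw.2 hw.1 hw.1 (hv.trans (Adj.reachable ?_))
      simpa using hvw
    by_cases hB₂ : B \ B₁ = ∅
    · intro v
      have hv : (v : V) ∈ B₁ := Finset.sdiff_eq_empty_iff_subset.1 hB₂ v.2
      exact (Finset.mem_filter.1 hv).2.2
    have huB₁ : (u : V) ∈ B₁ := Finset.mem_filter.2 ⟨u.2, u.2, Reachable.refl _⟩
    have he : excess G B = excess G B₁ + excess G (B \ B₁) := by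
      rw [← excess_union Finset.disjoint_sdiff hno, Finset.union_sdiff_of_subset hsub]
    have key : ∀ C ⊆ B, C.Nonempty → (∀ v ∈ C, ∀ w ∈ B, G.Adj v w → w ∈ C) → C ≠ B →
        c < excess G C := by
      intro C hC hCne hCcl hne
      by_contra! hle
      refine hne (hC.antisymm
        (hmin ⟨hCne, fun v hv => hBT v (hC hv), fun v hv w hvw => ?_, hle⟩ hC))
      exact (hBcl v (hC hv) w hvw).imp_left fun hw => hCcl v hv w hw hvw
    have h1 := key B₁ hsub ⟨u, huB₁⟩
      (fun v hv w hw hvw => by_contra fun hw' => hno v hv w (Finset.mem_sdiff.2 ⟨hw, hw'⟩) hvw)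
      (fun h => hB₂ (by rw [h, Finset.sdiff_self]))
    have h2 := key (B \ B₁) Finset.sdiff_subset (Finset.nonempty_iff_ne_empty.2 hB₂)
      (fun v hv w hw hvw => Finset.mem_sdiff.2 ⟨hw, fun hw' => hno w hw' v hv hvw.symm⟩)
      (fun h => (Finset.mem_sdiff.1 (h.ge (hsub huB₁))).2 huB₁)
    omega
  · obtain ⟨f, hf⟩ := hT.exists_retraction
    have hfB : ∀ v, f v ∉ B := fun v h => hBT _ h (hf.mem v)
    refine ⟨fun v => if v ∈ B then f v else v, fun v => ?_, fun v hv => ?_, fun u v huv => ?_⟩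
    · by_cases h : v ∈ B <;> simp [h, hfB]
    · simp only [Set.mem_compl_iff, Finset.mem_coe] at hv
      simp [hv]
    · by_cases hu : u ∈ B <;> by_cases hv : v ∈ B <;> simp only [hu, hv, if_true, if_false]
      · exact hf.adj u v huv
      · have := hf.fix v ((hBcl u hu v huv).resolve_left hv)
        have h := hf.adj u v huv
        rwa [this] at h
      · have := hf.fix u ((hBcl v hv u huv.symm).resolve_left hu)
        have h := hf.adj u v huv
        rwa [this] at h
      · exact Or.inr huv

open Classical in
/-- To bound the number of cops on connected subcubic graphs of bounded excess and order, it is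
enough to treat graphs of minimum degree at least two, knowing the bound for smaller graphs. -/
theorem copsWin_of_reduction {k n : ℕ} {e : ℤ}
    (h : ∀ (V : Type u) [Fintype V] (G : SimpleGraph V), G.Connected →
      (∀ v, 2 ≤ G.degree v ∧ G.degree v ≤ 3) → excess G Finset.univ ≤ e → Fintype.card V ≤ n →
      (∀ S : Finset V, S ≠ Finset.univ → (G.induce (S : Set V)).Connected →
        excess G S ≤ excess G Finset.univ → CopsWin (G.induce (S : Set V)) (k + 1)) →
      CopsWin G (k + 1))
    (V : Type u) [Fintype V] (G : SimpleGraph V) (hG : G.Connected) (hd : ∀ v, G.degree v ≤ 3)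
    (he : excess G Finset.univ ≤ e) (hn : Fintype.card V ≤ n) : CopsWin G (k + 1) := by
  induction hm : Fintype.card V using Nat.strong_induction_on generalizing V with
  | _ m ih =>
  subst hm
  have ih' : ∀ S : Finset V, S ≠ Finset.univ → (G.induce (S : Set V)).Connected →
      excess G S ≤ excess G Finset.univ → CopsWin (G.induce (S : Set V)) (k + 1) := by
    intro S hS hconn hex
    have hcard : Fintype.card (S : Set V) < Fintype.card V := by
      simpa using Finset.card_lt_card (Finset.ssubset_univ_iff.2 hS)
    refine ih _ hcard _ _ hconn (fun v => (degree_induce_le v).trans (hd v)) ?_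
      (hcard.le.trans hn) rfl
    rw [excess_induce_univ (S := S) (by simp)]
    exact hex.trans he
  by_cases hmin : ∀ v, 2 ≤ G.degree v
  · exact h V G hG (fun v => ⟨hmin v, hd v⟩) he hn ih'
  push Not at hmin
  obtain ⟨x, hx⟩ := hmin
  have := hG.nonempty
  rcases subsingleton_or_nontrivial V with hV | hV
  · exact copsWin_of_subsingleton G k
  have hx1 : G.degree x = 1 := by
    have := hG.preconnected.degree_pos_of_nontrivial x
    omega
  obtain ⟨y, hxy, hy⟩ := degree_eq_one_iff_existsUnique_adj.1 hx1
  have hg : IsRetraction G {x}ᶜ fun v => if v = x then y else v := by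
    refine ⟨fun v => ?_, fun v hv => if_neg hv, fun u v huv => ?_⟩
    · by_cases hv : v = x <;> simp [hv, hxy.ne']
    · by_cases hu : u = x <;> by_cases hv : v = x
      · exact Or.inl (by simp [hu, hv])
      · subst hu
        exact Or.inl (by simpa [hv] using hy v huv)
      · subst hv
        exact Or.inl (by simpa [hu] using (hy u huv.symm).symm)
      · exact Or.inr (by simpa [hu, hv] using huv)
  refine copsWin_of_pendant hg (by simpa using hxy.symm) (fun z hz => by simpa using hy z hz) ?_
  have hex : excess G {x} = -2 := by simp [excess]
  have hconn := hg.connected hG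
  have hS := ih' ({x}ᶜ : Finset V) (by simp)
  rw [Finset.coe_compl, Finset.coe_singleton] at hS
  refine hS hconn (excess_compl_le hG hex.ge (Finset.singleton_nonempty x) ⟨y, ?_⟩)
  simpa using hxy.ne'

open Classical in
theorem excess_nonneg_of_two_le_degree {V : Type*} [Fintype V] {G : SimpleGraph V}
    (h : ∀ v, 2 ≤ G.degree v) : 0 ≤ excess G Finset.univ := by
  rw [excess_univ]
  refine Finset.sum_nonneg fun v _ => ?_
  have := h v
  omega

open Classical in
theorem copsWin_one_of_excess_neg (V : Type u) [Fintype V] (G : SimpleGraph V) (hG : G.Connected)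
    (hd : ∀ v, G.degree v ≤ 3) (he : excess G Finset.univ ≤ -1) : CopsWin G 1 := by
  refine copsWin_of_reduction (k := 0) (fun W _ H _ hH he _ _ => ?_) V G hG hd he le_rfl
  have := excess_nonneg_of_two_le_degree fun v => (hH v).1
  omega

open Classical in
/-- One cop guards `T` while the others clear a piece of its complement. -/
theorem copsWin_of_guardable {k n : ℕ} {c e : ℤ} (hc : -1 ≤ c)
    (hB : ∀ (V : Type u) [Fintype V] (G : SimpleGraph V), G.Connected → (∀ v, G.degree v ≤ 3) →
      excess G Finset.univ ≤ c → CopsWin G k)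
    (hT : ∀ (V : Type u) [Fintype V] (G : SimpleGraph V), G.Connected →
      (∀ v, 2 ≤ G.degree v ∧ G.degree v ≤ 3) → excess G Finset.univ ≤ e → Fintype.card V ≤ n →
      ∃ T, Guardable G T ∧ excess G Tᶜ ≤ c)
    (V : Type u) [Fintype V] (G : SimpleGraph V) (hG : G.Connected) (hd : ∀ v, G.degree v ≤ 3)
    (he : excess G Finset.univ ≤ e) (hn : Fintype.card V ≤ n) : CopsWin G (k + 1) := by
  refine copsWin_of_reduction (fun W _ H hH hdeg he hn ih => ?_) V G hG hd he hn
  obtain ⟨T, hTg, hTc⟩ := hT W H hH hdeg he hn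
  have hne : Tᶜ.Nonempty := by
    rw [Finset.nonempty_iff_ne_empty, Ne, Finset.compl_eq_empty_iff]
    rintro rfl
    have := excess_nonneg_of_two_le_degree fun v => (hdeg v).1
    have := hTg.excess_le
    omega
  obtain ⟨B, hBc, hBconn, hBe, g, hg⟩ := hTg.exists_piece hc hne hTc
  have hBe' : excess (H.induce (B : Set W)) Finset.univ = excess H B :=
    excess_induce_univ (by simp)
  have hBne : B.Nonempty := by
    obtain ⟨b⟩ := hBconn.nonempty
    exact ⟨b, b.2⟩
  refine hg.copsWin_succ hH ?_ (hB _ _ hBconn (fun v => (degree_induce_le v).trans (hdeg v).2)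
    (hBe'.trans_le hBe))
  have := ih Bᶜ (by simpa [Finset.compl_eq_univ_iff] using hBne.ne_empty)
  rw [Finset.coe_compl] at this
  exact this (hg.connected hH) (excess_compl_le hH (hBe' ▸ hBconn.neg_two_le_excess) hBne hBc)

end Reduction

section Branch

variable {V : Type*} {G : SimpleGraph V}

/-- `w` lies strictly inside some geodesic from `u` to `v`. -/
def Between (G : SimpleGraph V) (u w v : V) : Prop :=
  w ≠ u ∧ w ≠ v ∧ G.dist u w + G.dist w v = G.dist u v

theorem Between.symm {u w v : V} (h : Between G u w v) : Between G v w u :=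
  ⟨h.2.1, h.1, by
    rw [SimpleGraph.dist_comm (u := v) (v := w), SimpleGraph.dist_comm (u := w) (v := u),
      SimpleGraph.dist_comm (u := v) (v := u), add_comm, h.2.2]⟩

theorem Between.ne {u w v : V} (hG : G.Connected) (h : Between G u w v) : u ≠ v := by
  rintro rfl
  have := h.2.2
  have := hG.pos_dist_of_ne h.1
  rw [SimpleGraph.dist_self] at *
  omega

variable [Fintype V]

open Classical in
/-- The vertices of degree at least three. -/
noncomputable def branch (G : SimpleGraph V) : Finset V := {v | 3 ≤ G.degree v}

open Classical in
theorem sum_degree_sub_two (hd : ∀ v, 2 ≤ G.degree v ∧ G.degree v ≤ 3) (T : Finset V) :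
    ∑ v ∈ T, ((G.degree v : ℤ) - 2) = (T ∩ branch G).card := by
  rw [branch, Finset.inter_filter, Finset.inter_univ, ← Finset.sum_boole]
  refine Finset.sum_congr rfl fun v _ => ?_
  have := hd v
  split_ifs <;> omega

open Classical in
theorem excess_univ_eq_card_branch (hd : ∀ v, 2 ≤ G.degree v ∧ G.degree v ≤ 3) :
    excess G Finset.univ = (branch G).card := by
  rw [excess_univ, sum_degree_sub_two hd, Finset.univ_inter]

open Classical in
theorem Guardable.excess_compl_le (hd : ∀ v, 2 ≤ G.degree v ∧ G.degree v ≤ 3) {T K : Finset V}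
    (hT : Guardable G T) (hK : K ⊆ branch G) (hKT : K ⊆ T) :
    excess G Tᶜ ≤ (branch G).card - 2 * K.card - 2 := by
  rw [excess_compl, excess_univ_eq_card_branch hd, sum_degree_sub_two hd]
  have h1 := Finset.card_le_card (Finset.subset_inter hKT hK)
  have h2 := hT.excess_le
  omega

/-- Distinct vertices are visible from each other if no geodesic between them passes through a
vertex of degree three. -/
def Visible (G : SimpleGraph V) (u v : V) : Prop :=
  u ≠ v ∧ ∀ w ∈ branch G, ¬ Between G u w v

theorem Visible.symm {u v : V} (h : Visible G u v) : Visible G v u :=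
  ⟨h.1.symm, fun w hw hb => h.2 w hw hb.symm⟩

theorem dist_eq_add_of_forced (hG : G.Connected) (v v' : V) (a c : V) (hac : G.Adj a c)
    (hv : G.dist a v = G.dist c v + 1) (hv' : G.dist a v' = G.dist c v' + 1)
    (hle : G.dist c v ≤ G.dist c v')
    (hb : ∀ w ∈ branch G, w ≠ v → G.dist c w + G.dist w v ≠ G.dist c v)
    (hb' : ∀ w ∈ branch G, w ≠ v' → G.dist c w + G.dist w v' ≠ G.dist c v') :
    G.dist c v' = G.dist c v + G.dist v v' := by
  classical
  induction hn : G.dist c v generalizing a c with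
  | zero =>
    rw [hG.dist_eq_zero_iff] at hn
    rw [hn, zero_add]
  | succ n ih =>
    have hcv : c ≠ v := by
      rintro rfl
      simp at hn
    have hcv' : c ≠ v' := by
      rintro rfl
      rw [SimpleGraph.dist_self] at hle
      omega
    obtain ⟨e, hce, he⟩ := hG.exists_adj_dist_add_one hcv
    obtain ⟨e', hce', he'⟩ := hG.exists_adj_dist_add_one hcv'
    have hc : c ∉ branch G := fun h => hb c h hcv (by simp)
    have hae : a ≠ e := by
      rintro rfl
      omega
    have hae' : a ≠ e' := by
      rintro rfl
      omega
    obtain rfl : e = e' := by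
      by_contra hne
      refine hc ?_
      simp only [branch, Finset.mem_filter, Finset.mem_univ, true_and]
      rw [← Finset.card_eq_three.2 ⟨a, e, e', hae, hae', hne, rfl⟩, ← card_neighborFinset_eq_degree]
      refine Finset.card_le_card ?_
      simp [Finset.insert_subset_iff, hac.symm, hce, hce']
    have hd := dist_eq_one_iff_adj.2 hce
    have := ih c e hce he.symm he'.symm (by omega) (fun w hw hwv h => ?_) (fun w hw hwv h => ?_)
      (by omega)
    · omega
    · have h1 := hG.dist_triangle (u := c) (v := e) (w := w)
      have h2 := hG.dist_triangle (u := c) (v := w) (w := v)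
      exact hb w hw hwv (by omega)
    · have h1 := hG.dist_triangle (u := c) (v := e) (w := w)
      have h2 := hG.dist_triangle (u := c) (v := w) (w := v')
      exact hb' w hw hwv (by omega)

open Classical in
theorem card_visible_le (hG : G.Connected) (u : V) :
    ((branch G).filter (Visible G u)).card ≤ G.degree u := by
  have hstep : ∀ v, ∃ c, u ≠ v → G.Adj u c ∧ G.dist c v + 1 = G.dist u v := by
    intro v
    by_cases h : u = v
    · exact ⟨u, fun h' => absurd h h'⟩
    · exact (hG.exists_adj_dist_add_one h).imp fun _ h _ => h
  choose c hc using hstep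
  rw [← card_neighborFinset_eq_degree]
  refine Finset.card_le_card_of_injOn c (fun v hv => ?_) ?_
  · simpa using (hc v (Finset.mem_filter.1 hv).2.1).1
  · have hinside : ∀ v, Visible G u v → ∀ w ∈ branch G, w ≠ v →
        G.dist (c v) w + G.dist w v ≠ G.dist (c v) v := by
      intro v hv w hw hwv h
      obtain ⟨h1, h2⟩ := hc v hv.1
      have h3 := dist_eq_one_iff_adj.2 h1
      have h4 := hG.dist_triangle (u := u) (v := c v) (w := w)
      have h5 := hG.dist_triangle (u := u) (v := w) (w := v)
      refine hv.2 w hw ⟨?_, hwv, by omega⟩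
      rintro rfl
      omega
    have key : ∀ v ∈ branch G, ∀ v' ∈ branch G, Visible G u v → Visible G u v' → c v = c v' →
        G.dist (c v) v ≤ G.dist (c v) v' → v = v' := by
      intro v hvb v' _ hv hv' hcc hle
      by_contra hne
      obtain ⟨h1, h2⟩ := hc v hv.1
      obtain ⟨h1', h2'⟩ := hc v' hv'.1
      rw [← hcc] at h2'
      have := dist_eq_add_of_forced hG v v' u (c v) h1 h2.symm h2'.symm hle (hinside v hv)
        (hcc ▸ hinside v' hv')
      exact hv'.2 v hvb ⟨hv.1.symm, hne, by omega⟩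
    intro v hv v' hv' hcc
    simp only [Finset.coe_filter, Set.mem_ofPred_eq] at hv hv'
    rcases le_total (G.dist (c v) v) (G.dist (c v) v') with h | h
    · exact key v hv.1 v' hv'.1 hv.2 hv'.2 hcc h
    · rw [hcc] at h
      exact (key v' hv'.1 v hv.1 hv'.2 hv.2 hcc.symm h).symm

end Branch

/-! ### Eight branch vertices -/

theorem exists_center_of_card_le_three {X : Type*} [Fintype X] [DecidableEq X] (R : X → X → Prop)
    [DecidableRel R] (N : Finset X) (hN : N.card ≤ 3) (hsymm : ∀ x y, R x y → R y x)
    (hR : ∀ x y, R x y → x ∈ N ∧ x ≠ y) (htri : ∀ x y z, R x y → R y z → ¬ R x z) :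
    (Finset.univ.filter fun p : X × X => R p.1 p.2).card ≤ 4 ∧
      (4 ≤ (Finset.univ.filter fun p : X × X => R p.1 p.2).card → N.card = 3 ∧
        ∃ s ∈ N, ∀ x ∈ N, ∀ y ∈ N, x ≠ y → (R x y ↔ x = s ∨ y = s)) := by
  set P := Finset.univ.filter fun p : X × X => R p.1 p.2 with hP
  have hPN : P ⊆ N.offDiag := by
    rintro ⟨x, y⟩ h
    have h : R x y := by simpa [hP] using h
    exact Finset.mem_offDiag.2 ⟨(hR x y h).1, (hR y x (hsymm x y h)).1, (hR x y h).2⟩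
  by_cases h3 : N.card = 3
  · have key : ∀ a b c, a ≠ b → a ≠ c → b ≠ c → N = {a, b, c} → ¬ R b c → P.card ≤ 4 ∧
        (4 ≤ P.card → N.card = 3 ∧ ∃ s ∈ N, ∀ x ∈ N, ∀ y ∈ N, x ≠ y → (R x y ↔ x = s ∨ y = s)) := by
      intro a b c hab hac hbc hNe hbcR
      have hcbR : ¬ R c b := fun h => hbcR (hsymm _ _ h)
      have hsub : P ⊆ {(a, b), (b, a), (a, c), (c, a)} := by
        rintro ⟨x, y⟩ h
        have h1 := Finset.mem_offDiag.1 (hPN h)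
        have h2 : R x y := by simpa [hP] using h
        simp only [hNe, Finset.mem_insert, Finset.mem_singleton] at h1
        simp only [Finset.mem_insert, Finset.mem_singleton, Prod.mk.injEq]
        obtain ⟨rfl | rfl | rfl, rfl | rfl | rfl, h⟩ := h1 <;> simp_all
      refine ⟨(Finset.card_le_card hsub).trans Finset.card_le_four, fun h4 => ⟨h3, a, ?_, ?_⟩⟩
      · simp [hNe]
      · have hPe := Finset.eq_of_subset_of_card_le hsub (Finset.card_le_four.trans h4)
        have hab' : R a b := by
          have : (a, b) ∈ P := by simp [hPe]
          simpa [hP] using this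
        have hac' : R a c := by
          have : (a, c) ∈ P := by simp [hPe]
          simpa [hP] using this
        have hba' := hsymm _ _ hab'
        have hca' := hsymm _ _ hac'
        intro x hx y hy hxy
        simp only [hNe, Finset.mem_insert, Finset.mem_singleton] at hx hy
        obtain rfl | rfl | rfl := hx <;> obtain rfl | rfl | rfl := hy <;> simp_all [Ne.symm]
    obtain ⟨a, b, c, hab, hac, hbc, hNe⟩ := Finset.card_eq_three.1 h3
    by_cases hbcR : R b c
    · by_cases hacR : R a c
      · refine key c a b hac.symm hbc.symm hab ?_ fun h => htri a b c h hbcR hacR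
        rw [hNe]
        ext
        simp only [Finset.mem_insert, Finset.mem_singleton]
        tauto
      · refine key b a c hab.symm hbc hac ?_ hacR
        rw [hNe]
        ext
        simp only [Finset.mem_insert, Finset.mem_singleton]
        tauto
    · exact key a b c hab hac hbc hNe hbcR
  · have h2 : N.card ≤ 2 := by omega
    have h4 : P.card ≤ 2 := by
      refine (Finset.card_le_card hPN).trans ?_
      rw [Finset.offDiag_card]
      interval_cases N.card <;> simp
    exact ⟨by omega, fun h => by omega⟩

/-- A betweenness relation `B` (its second argument being the middle one) of a finite metric, with
`Vis` the relation of having no point in between, in which chains have at most three points, points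
see at most three others, and no point is between all pairs of a triple. -/
structure IsSparseBetweenness {X : Type*} (d : X → X → ℕ) (B : X → X → X → Prop)
    (Vis : X → X → Prop) : Prop where
  dist_comm : ∀ x y, d x y = d y x
  dist_eq : ∀ x w y, B x w y → d x w + d w y = d x y
  dist_lt : ∀ x w y, w ≠ x → w ≠ y → ¬ B x w y → d x y < d x w + d w y
  symm : ∀ x w y, B x w y → B y w x
  ne : ∀ x w y, B x w y → x ≠ y
  vis_ne : ∀ x y, Vis x y → x ≠ y
  vis_symm : ∀ x y, Vis x y → Vis y x
  not_vis : ∀ x w y, B x w y → ¬ Vis x y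
  vis_or : ∀ x y, x ≠ y → Vis x y ∨ ∃ w, B x w y
  vis : ∀ x w y, B x w y → Vis x w
  card_vis : ∀ x (N : Finset X), (∀ y ∈ N, Vis x y) → N.card ≤ 3
  no_tripod : ∀ w x y z, B x w y → B y w z → ¬ B x w z

namespace IsSparseBetweenness

variable {X : Type*} [Fintype X] {d : X → X → ℕ} {B : X → X → X → Prop} {Vis : X → X → Prop}

open Classical in
/-- In the extremal case of eight points, each point `w` has three visible points, one of which,
`s w`, is such that `w` is between two of them if and only if one of the two is `s w`. -/
theorem exists_center (h : IsSparseBetweenness d B Vis) (hX : Fintype.card X = 8) :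
    (∀ x w w' y, B x w y → B x w' y → w = w') ∧
    (∀ w, (Finset.univ.filter (Vis w)).card = 3) ∧
    ∃ s : X → X, (∀ w, Vis w (s w)) ∧
      ∀ w x y, Vis w x → Vis w y → x ≠ y → (B x w y ↔ x = s w ∨ y = s w) := by
  have hc : ∀ w, (Finset.univ.filter (Vis w)).card ≤ 3 := fun w => h.card_vis w _ (by simp)
  have hcent := fun w => exists_center_of_card_le_three (fun x y => B x w y)
    (Finset.univ.filter (Vis w)) (hc w) (fun x y => h.symm x w y)
    (fun x y hb => ⟨by simpa using h.vis_symm _ _ (h.vis x w y hb), h.ne x w y hb⟩)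
    (fun x y z => h.no_tripod w x y z)
  set M : X → ℕ := fun w => (Finset.univ.filter fun p : X × X => B p.1 w p.2).card with hM
  set P : Finset (X × X) := Finset.univ.filter fun p => p.1 ≠ p.2 ∧ ¬ Vis p.1 p.2 with hP
  have hPcard : 32 ≤ P.card := by
    have h1 : P.card = ∑ x, (Finset.univ.filter fun y => x ≠ y ∧ ¬ Vis x y).card := by
      rw [hP, Finset.card_filter, Fintype.sum_prod_type]
      simp only [Finset.card_filter]
    have h2 : ∀ x, 4 ≤ (Finset.univ.filter fun y => x ≠ y ∧ ¬ Vis x y).card := by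
      intro x
      have h3 : (Finset.univ : Finset X) ⊆ insert x (Finset.univ.filter (Vis x) ∪
          Finset.univ.filter fun y => x ≠ y ∧ ¬ Vis x y) := by
        intro y _
        simp only [Finset.mem_insert, Finset.mem_union, Finset.mem_filter, Finset.mem_univ]
        tauto
      have h4 := (Finset.card_le_card h3).trans ((Finset.card_insert_le _ _).trans
        (Nat.add_le_add_right (Finset.card_union_le _ _) 1))
      rw [Finset.card_univ, hX] at h4
      have := hc x
      omega
    calc 32 = ∑ _x : X, 4 := by simp [hX]
      _ ≤ _ := Finset.sum_le_sum fun x _ => h2 x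
      _ = P.card := h1.symm
  have hle : ∑ w, M w ≤ 32 := by
    calc ∑ w, M w ≤ ∑ _w : X, 4 := Finset.sum_le_sum fun w _ => (hcent w).1
      _ = 32 := by simp [hX]
  have hswap : ∑ w, M w = ∑ p : X × X, (Finset.univ.filter fun w => B p.1 w p.2).card := by
    simp only [hM, Finset.card_filter]
    exact Finset.sum_comm
  have hone : ∀ p ∈ P, 1 ≤ (Finset.univ.filter fun w => B p.1 w p.2).card := by
    intro p hp
    obtain ⟨hne, hv⟩ := (Finset.mem_filter.1 hp).2
    obtain ⟨w, hw⟩ := (h.vis_or _ _ hne).resolve_left hv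
    exact Finset.card_pos.2 ⟨w, by simpa using hw⟩
  have hPle : ∑ p ∈ P, (Finset.univ.filter fun w => B p.1 w p.2).card ≤ ∑ w, M w := by
    rw [hswap]
    exact Finset.sum_le_sum_of_subset (Finset.subset_univ _)
  have hP1 : P.card = ∑ _p ∈ P, 1 := by simp
  have hM4 : ∀ w, 4 ≤ M w := by
    intro w
    by_contra! hlt
    have h1 : ∑ w, M w < ∑ _w : X, 4 :=
      Finset.sum_lt_sum (fun w _ => (hcent w).1) ⟨w, Finset.mem_univ _, hlt⟩
    have h2 : ∑ _w : X, 4 = 32 := by simp [hX]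
    have h3 := Finset.sum_le_sum hone
    omega
  refine ⟨fun x w w' y hw hw' => ?_, fun w => ((hcent w).2 (hM4 w)).1, ?_⟩
  · by_contra hne
    have hxy : (x, y) ∈ P := by
      simpa [hP] using ⟨h.ne x w y hw, h.not_vis x w y hw⟩
    have h2 : 1 < (Finset.univ.filter fun w => B x w y).card :=
      Finset.one_lt_card.2 ⟨w, by simpa using hw, w', by simpa using hw', hne⟩
    have h3 := Finset.sum_lt_sum hone ⟨(x, y), hxy, h2⟩
    omega
  · choose s hs hB using fun w => ((hcent w).2 (hM4 w)).2
    exact ⟨s, fun w => by simpa using hs w,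
      fun w x y hx hy => hB w x (by simpa using hx) y (by simpa using hy)⟩

/-- A betweenness relation as above has at most seven points. -/
theorem card_ne_eight (h : IsSparseBetweenness d B Vis) : Fintype.card X ≠ 8 := by
  classical
  intro hX
  obtain ⟨huniq, hN, s, hs, hB⟩ := h.exists_center hX
  have hsurj : Function.Surjective s := by
    intro u
    by_contra! hu
    have hsub : (Finset.univ : Finset X) ⊆ insert u (Finset.univ.filter (Vis u) ∪
        (Finset.univ.filter (Vis u)).image s) := by
      intro z _
      simp only [Finset.mem_insert, Finset.mem_union, Finset.mem_filter, Finset.mem_univ,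
        Finset.mem_image, true_and]
      by_cases hz : z = u
      · exact Or.inl hz
      refine Or.inr ((h.vis_or u z (Ne.symm hz)).imp_right fun ⟨w, hw⟩ => ⟨w, h.vis _ _ _ hw, ?_⟩)
      have h1 := h.vis_symm _ _ (h.vis _ _ _ hw)
      have h2 := h.vis_symm _ _ (h.vis _ _ _ (h.symm _ _ _ hw))
      exact (((hB w u z h1 h2 (Ne.symm hz)).1 hw).resolve_left fun e => hu w e.symm).symm
    have h1 := (Finset.card_le_card hsub).trans ((Finset.card_insert_le _ _).trans
      (Nat.add_le_add_right (Finset.card_union_le _ _) 1))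
    have h2 := Finset.card_image_le (s := Finset.univ.filter (Vis u)) (f := s)
    rw [Finset.card_univ, hX] at h1
    rw [hN u] at h1 h2
    omega
  have hinj : Function.Injective s := Finite.injective_iff_surjective.2 hsurj
  have hbet : ∀ w x, Vis w x → x ≠ s w → B (s w) w x := fun w x hx hne =>
    (hB w (s w) x (hs w) hx hne.symm).2 (Or.inl rfl)
  have hcycle : ∀ u, s (s u) ≠ u := by
    have key : ∀ u a, s u = a → s a = u → ∀ x, Vis u x → x ≠ a →
        ¬ Vis u (s x) ∧ ¬ Vis a (s x) := by
      intro u a hua hau x hux hxa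
      have hxu : x ≠ u := (h.vis_ne _ _ hux).symm
      refine ⟨fun hv => ?_, fun hv => ?_⟩
      · exact h.not_vis _ _ _ (hbet x u (h.vis_symm _ _ hux) (h.vis_ne _ _ hv)) (h.vis_symm _ _ hv)
      · have hne : s x ≠ u := fun e => hxa (hinj (e.trans hau.symm))
        have h1 := hbet x u (h.vis_symm _ _ hux) hne.symm
        have h2 := hbet a (s x) hv (hau ▸ hne)
        rw [hau] at h2
        exact hxa (huniq _ _ _ _ h1 (h.symm _ _ _ h2))
    intro u hu
    set a := s u with ha
    have hN6 : Disjoint (Finset.univ.filter (Vis u)) (Finset.univ.filter (Vis a)) := by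
      rw [Finset.disjoint_left]
      simp only [Finset.mem_filter, Finset.mem_univ, true_and]
      intro x hux hax
      exact h.not_vis _ _ _ (hbet u x hux (h.vis_ne _ _ hax).symm) hax
    have hua : Vis u a := hs u
    have hau : Vis a u := h.vis_symm _ _ hua
    have hsub : (((Finset.univ.filter (Vis u)).erase a ∪ (Finset.univ.filter (Vis a)).erase u).image
        s) ⊆ (Finset.univ.filter (Vis u) ∪ Finset.univ.filter (Vis a))ᶜ := by
      intro z hz
      obtain ⟨x, hx, rfl⟩ := Finset.mem_image.1 hz
      simp only [Finset.mem_union, Finset.mem_erase, Finset.mem_filter, Finset.mem_univ,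
        true_and, Finset.mem_compl, not_or] at hx ⊢
      rcases hx with ⟨hxa, hux⟩ | ⟨hxu, hax⟩
      · exact key u a rfl hu x hux hxa
      · exact (key a u hu rfl x hax hxu).symm
    have hcard := Finset.card_le_card hsub
    rw [Finset.card_image_of_injective _ hinj, Finset.card_compl, hX,
      Finset.card_union_of_disjoint hN6, Finset.card_union_of_disjoint
        (hN6.mono (Finset.erase_subset _ _) (Finset.erase_subset _ _)),
      Finset.card_erase_of_mem (by simpa using hua), Finset.card_erase_of_mem (by simpa using hau),
      hN, hN] at hcard
    omega
  have hmain : ∀ n w x, d w x = n → Vis w x → s w ≠ x → s x ≠ w → False := by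
    intro n
    induction n using Nat.strong_induction_on with
    | _ n ih =>
    intro w x hn hwx hsw hsx'
    obtain ⟨y, rfl⟩ := hsurj w
    set w := s y with hw
    have hyw : Vis y w := hs y
    have hyx : y ≠ x := by
      rintro rfl
      exact hsx' rfl
    have hwy : Vis w y := h.vis_symm _ _ hyw
    have hwx' := h.vis_ne _ _ hwx
    have hnB : ¬ B x w y := by
      rw [hB w x y hwx hwy hyx.symm]
      rintro (e | e)
      · exact hsw e.symm
      · exact hcycle y e.symm
    rcases h.vis_or x y hyx.symm with hxy | ⟨q, hq⟩
    · exact h.not_vis _ _ _ (hbet y x (h.vis_symm _ _ hxy) hwx'.symm) hwx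
    have hqw : q ≠ w := by
      rintro rfl
      exact hnB hq
    have hxq := h.vis _ _ _ hq
    have hyq := h.vis _ _ _ (h.symm _ _ _ hq)
    have hwyq : B w y q := hbet y q hyq hqw
    have hnB' : ¬ B w x q := fun hb => hyx (huniq _ _ _ _ hwyq hb)
    have hxq' := h.vis_ne _ _ hxq
    rcases (hB q x y (h.vis_symm _ _ hxq) (h.vis_symm _ _ hyq) hyx.symm).1 hq with e | e
    · have h1 := h.dist_lt w x q hwx'.symm hxq' hnB'
      have h2 := h.dist_lt x w y hwx' (h.vis_ne _ _ hwy) hnB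
      have h3 := h.dist_eq _ _ _ hwyq
      have h4 := h.dist_eq _ _ _ hq
      have h5 := h.dist_comm x w
      have h6 := h.dist_comm q y
      exact ih (d y q) (by omega) y q rfl hyq hqw.symm (by rw [← e]; exact hyx.symm)
    · obtain ⟨p, hp⟩ := hsurj x
      have hxw := h.vis_symm _ _ hwx
      rw [hB x w q hxw hxq hqw.symm, not_or] at hnB'
      have hxp : Vis x p := h.vis_symm _ _ (hp ▸ hs p)
      have hpw : p ≠ w := by
        rintro rfl
        exact hsw hp
      have hpq : p ≠ q := by
        rintro rfl
        exact hyx (e.trans hp)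
      have hps : s x ≠ p := by
        rintro rfl
        exact hcycle x hp
      have h4 := h.card_vis x {w, q, p, s x} (by simp [hxw, hxq, hxp, hs x])
      rw [Finset.card_insert_of_notMem (by simp [hqw.symm, hpw.symm, hnB'.1]),
        Finset.card_eq_three.2 ⟨q, p, s x, hpq.symm, hnB'.2, hps.symm, rfl⟩] at h4
      exact absurd h4 (by decide)
  obtain ⟨w⟩ : Nonempty X := Fintype.card_pos_iff.1 (by omega)
  obtain ⟨y, hy⟩ := hsurj w
  obtain ⟨x, hx, hx'⟩ : ∃ x ∈ Finset.univ.filter (Vis w), x ∉ ({s w, y} : Finset X) := by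
    refine Finset.exists_mem_notMem_of_card_lt_card ?_
    rw [hN]
    exact Finset.card_le_two.trans_lt (by decide)
  simp only [Finset.mem_insert, Finset.mem_singleton, not_or] at hx'
  refine hmain _ w x rfl (by simpa using hx) (Ne.symm hx'.1) fun e => hx'.2 (hinj (e.trans hy.symm))

end IsSparseBetweenness

theorem IsSparseBetweenness.card_le_thirteen {X : Type*} [Fintype X] {d : X → X → ℕ}
    {B : X → X → X → Prop} {Vis : X → X → Prop} (h : IsSparseBetweenness d B Vis) :
    Fintype.card X ≤ 13 := by
  classical
  rcases isEmpty_or_nonempty X with hX | ⟨⟨u⟩⟩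
  · simp
  have hc : ∀ w, (Finset.univ.filter (Vis w)).card ≤ 3 := fun w => h.card_vis w _ (by simp)
  have hsub : (Finset.univ : Finset X) ⊆ insert u (Finset.univ.filter (Vis u) ∪
      (Finset.univ.filter (Vis u)).biUnion fun w => Finset.univ.filter (Vis w)) := by
    intro z _
    simp only [Finset.mem_insert, Finset.mem_union, Finset.mem_filter, Finset.mem_univ,
      Finset.mem_biUnion, true_and]
    by_cases hz : z = u
    · exact Or.inl hz
    refine Or.inr ((h.vis_or u z (Ne.symm hz)).imp_right fun ⟨w, hw⟩ => ⟨w, h.vis _ _ _ hw, ?_⟩)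
    exact h.vis_symm _ _ (h.vis _ _ _ (h.symm _ _ _ hw))
  have h1 := (Finset.card_le_card hsub).trans ((Finset.card_insert_le _ _).trans
    (Nat.add_le_add_right (Finset.card_union_le _ _) 1))
  have h2 := Finset.card_biUnion_le_card_mul (Finset.univ.filter (Vis u))
    (fun w => Finset.univ.filter (Vis w)) 3 fun w _ => hc w
  have := hc u
  rw [Finset.card_univ] at h1
  omega

section Selection

variable {V : Type*} [Fintype V] {G : SimpleGraph V}

/-- Some guardable set contains at least `k` branch vertices. -/
def HasGuard (G : SimpleGraph V) (k : ℕ) : Prop :=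
  ∃ T K, Guardable G T ∧ K ⊆ branch G ∧ K ⊆ T ∧ k ≤ K.card

open Classical in
theorem HasGuard.exists_excess_compl_le (hd : ∀ v, 2 ≤ G.degree v ∧ G.degree v ≤ 3) {k : ℕ}
    (h : HasGuard G k) {c : ℤ} (hc : (branch G).card - 2 * k - 2 ≤ c) :
    ∃ T, Guardable G T ∧ excess G Tᶜ ≤ c := by
  obtain ⟨T, K, hT, hK, hKT, hk⟩ := h
  have := hT.excess_compl_le hd hK hKT
  exact ⟨T, hT, by omega⟩

theorem hasGuard_zero (hG : G.Connected) : HasGuard G 0 := by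
  obtain ⟨y⟩ := hG.nonempty
  obtain ⟨T, hT, -⟩ := exists_guardable_spider hG y (Empty.elim) (Empty.elim) (fun i => i.elim)
    fun i => i.elim
  exact ⟨T, ∅, hT, by simp, by simp, by simp⟩

theorem hasGuard_two (hG : G.Connected) (h : 2 ≤ (branch G).card) : HasGuard G 2 := by
  classical
  obtain ⟨u, hu, v, hv, huv⟩ := Finset.one_lt_card.1 h
  obtain ⟨T, hT, hyT, hwT⟩ := exists_guardable_spider hG u (fun _ : Unit => v) (fun _ => v)
    (by simp) (fun i j hij => absurd rfl hij)
  refine ⟨T, {u, v}, hT, ?_, ?_, (Finset.card_pair huv).ge⟩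
  · simp [Finset.insert_subset_iff, hu, hv]
  · simp [Finset.insert_subset_iff, hyT, (hwT ()).1]

theorem Between.hasGuard (hG : G.Connected) {u w v : V} (h : Between G u w v) (hu : u ∈ branch G)
    (hw : w ∈ branch G) (hv : v ∈ branch G) : HasGuard G 3 := by
  classical
  obtain ⟨T, hT, hyT, hwT⟩ := exists_guardable_spider hG u (fun _ : Unit => v) (fun _ => w)
    (fun _ => h.2.2) (fun i j hij => absurd rfl hij)
  refine ⟨T, {u, w, v}, hT, ?_, ?_, ?_⟩
  · simp [Finset.insert_subset_iff, hu, hv, hw]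
  · simp [Finset.insert_subset_iff, hyT, hwT ()]
  · exact (Finset.card_eq_three.2 ⟨u, w, v, h.1.symm, h.ne hG, h.2.1, rfl⟩).ge

open Classical in
theorem hasGuard_three (hG : G.Connected) (hd : ∀ v, G.degree v ≤ 3) (h : 5 ≤ (branch G).card) :
    HasGuard G 3 := by
  obtain ⟨u, hu⟩ : (branch G).Nonempty := Finset.card_pos.1 (by omega)
  have h1 := (card_visible_le hG u).trans (hd u)
  obtain ⟨v, hv, hv'⟩ := Finset.exists_mem_notMem_of_card_lt_card
    (s := insert u ((branch G).filter (Visible G u))) (t := branch G)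
    (by have := Finset.card_insert_le u ((branch G).filter (Visible G u)); omega)
  simp only [Finset.mem_insert, Finset.mem_filter, hv, true_and, not_or, Visible, not_and,
    not_forall, not_not] at hv'
  obtain ⟨w, hw, hb⟩ := hv'.2 (Ne.symm hv'.1)
  exact hb.hasGuard hG hu hw hv

theorem hasGuard_four_of_chain (hG : G.Connected) {u a b v : V} (h : Between G u b v)
    (h' : Between G u a b) (hu : u ∈ branch G) (ha : a ∈ branch G) (hb : b ∈ branch G)
    (hv : v ∈ branch G) : HasGuard G 4 := by
  classical
  have h1 := h.2.2
  have h2 := h'.2.2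
  have h3 := hG.dist_triangle (u := u) (v := a) (w := v)
  have h4 := hG.dist_triangle (u := a) (v := b) (w := v)
  have hua := SimpleGraph.dist_comm (G := G) (u := u) (v := a)
  have huv := SimpleGraph.dist_comm (G := G) (u := u) (v := v)
  have hav : a ≠ v := by
    rintro rfl
    have := hG.pos_dist_of_ne h'.2.1
    omega
  obtain ⟨T, hT, hyT, hwT⟩ := exists_guardable_spider hG a ![u, v] ![u, b]
    (by simp [Fin.forall_fin_two]; omega)
    (by
      simp only [Fin.forall_fin_two, Matrix.cons_val_zero, Matrix.cons_val_one]
      refine ⟨⟨fun h => absurd rfl h, fun _ => ?_⟩, fun _ => ?_, fun h => absurd rfl h⟩ <;> omega)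
  simp only [Fin.forall_fin_two, Matrix.cons_val_zero, Matrix.cons_val_one] at hwT
  refine ⟨T, {u, a, b, v}, hT, ?_, ?_, ?_⟩
  · simp [Finset.insert_subset_iff, hu, ha, hb, hv]
  · simp [Finset.insert_subset_iff, hyT, hwT]
  · rw [Finset.card_insert_of_notMem (by simp [h'.1.symm, h.1.symm, h.ne hG]),
      Finset.card_eq_three.2 ⟨a, b, v, h'.2.1, hav, h.2.1, rfl⟩]

theorem hasGuard_four_of_tripod (hG : G.Connected) {w x y z : V} (hxy : Between G x w y)
    (hyz : Between G y w z) (hxz : Between G x w z) (hw : w ∈ branch G) (hx : x ∈ branch G)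
    (hy : y ∈ branch G) (hz : z ∈ branch G) : HasGuard G 4 := by
  classical
  obtain ⟨T, hT, hyT, hwT⟩ := exists_guardable_spider hG w ![x, y, z] ![x, y, z] (by simp)
    (by
      have h1 := hxy.2.2
      have h2 := hyz.2.2
      have h3 := hxz.2.2
      have h4 := hxy.symm.2.2
      have h5 := hyz.symm.2.2
      have h6 := hxz.symm.2.2
      have h7 := SimpleGraph.dist_comm (G := G) (u := w) (v := x)
      have h8 := SimpleGraph.dist_comm (G := G) (u := w) (v := y)
      have h9 := SimpleGraph.dist_comm (G := G) (u := w) (v := z)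
      intro i j hij
      fin_cases i <;> fin_cases j <;> simp at hij ⊢ <;> omega)
  have hwT := And.intro (hwT 0).1 (And.intro (hwT 1).1 (hwT 2).1)
  simp only [Matrix.cons_val] at hwT
  refine ⟨T, {w, x, y, z}, hT, ?_, ?_, ?_⟩
  · simp [Finset.insert_subset_iff, hw, hx, hy, hz]
  · simp [Finset.insert_subset_iff, hyT, hwT]
  · rw [Finset.card_insert_of_notMem (by simp [hxy.1, hxy.2.1, hyz.2.1]),
      Finset.card_eq_three.2 ⟨x, y, z, hxy.ne hG, hxz.ne hG, hyz.ne hG, rfl⟩]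

open Classical in
theorem isSparseBetweenness_of_not_hasGuard (hG : G.Connected) (hd : ∀ v, G.degree v ≤ 3)
    (h : ¬ HasGuard G 4) :
    IsSparseBetweenness (X := branch G) (fun u v => G.dist u v) (fun u w v => Between G u w v)
      (fun u v => Visible G u v) where
  dist_comm _ _ := SimpleGraph.dist_comm
  dist_eq _ _ _ hb := hb.2.2
  dist_lt x w y hx hy hb := by
    refine lt_of_le_of_ne hG.dist_triangle fun e => hb ⟨?_, ?_, e.symm⟩
    · exact fun e => hx (Subtype.ext e)
    · exact fun e => hy (Subtype.ext e)
  symm _ _ _ hb := hb.symm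
  ne _ _ _ hb e := hb.ne hG (congrArg _ e)
  vis_ne _ _ hv e := hv.1 (congrArg _ e)
  vis_symm _ _ hv := hv.symm
  not_vis _ w _ hb hv := hv.2 w w.2 hb
  vis_or x y hxy := by
    by_contra! hcon
    exact hcon.1 ⟨fun e => hxy (Subtype.ext e), fun w hw => hcon.2 ⟨w, hw⟩⟩
  vis x w y hb := by
    refine ⟨hb.1.symm, fun t ht hbt => h ?_⟩
    exact hasGuard_four_of_chain hG hb hbt x.2 ht w.2 y.2
  card_vis x N hN := by
    refine le_trans ?_ ((card_visible_le hG (x : V)).trans (hd x))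
    rw [← Finset.card_map (Function.Embedding.subtype _)]
    refine Finset.card_le_card fun y hy => ?_
    obtain ⟨z, hz, rfl⟩ := Finset.mem_map.1 hy
    exact Finset.mem_filter.2 ⟨z.2, hN z hz⟩
  no_tripod w x y z hxy hyz hxz :=
    h (hasGuard_four_of_tripod hG hxy hyz hxz w.2 x.2 y.2 z.2)

open Classical in
theorem hasGuard_four (hG : G.Connected) (hd : ∀ v, G.degree v ≤ 3)
    (h : (branch G).card = 8 ∨ 14 ≤ (branch G).card) : HasGuard G 4 := by
  by_contra hcon
  have hs := isSparseBetweenness_of_not_hasGuard hG hd hcon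
  have h1 := hs.card_ne_eight
  have h2 := hs.card_le_thirteen
  rw [Fintype.card_coe] at h1 h2
  omega

end Selection

section Cubic

variable {V : Type*} {G : SimpleGraph V}

theorem exists_adj_dist_eq (hG : G.Connected) {a v : V} {n : ℕ} (hv : G.dist a v = n + 1) :
    ∃ w, G.Adj v w ∧ G.dist a w = n := by
  obtain ⟨w, hvw, hw⟩ := hG.exists_adj_dist_add_one (u := v) (v := a) (by
    rintro rfl
    simp at hv)
  rw [SimpleGraph.dist_comm, SimpleGraph.dist_comm (u := v)] at hw
  exact ⟨w, hvw, by omega⟩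

variable [Fintype V]

open Classical in
/-- The neighbours of `v` that are farther from `a` than `v` is. -/
noncomputable def upNeighbors (G : SimpleGraph V) (a v : V) : Finset V :=
  (G.neighborFinset v).filter fun w => G.dist a w = G.dist a v + 1

open Classical in
theorem card_upNeighbors_le {a v : V} (C : Finset V) (hC : ∀ w ∈ C, G.Adj v w)
    (hC' : ∀ w ∈ C, G.dist a w ≤ G.dist a v) :
    (upNeighbors G a v).card + C.card ≤ G.degree v := by
  have hdisj : Disjoint (upNeighbors G a v) C := by
    rw [Finset.disjoint_left]
    intro w hw hwC
    have := (Finset.mem_filter.1 hw).2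
    have := hC' w hwC
    omega
  rw [← Finset.card_union_of_disjoint hdisj, ← card_neighborFinset_eq_degree]
  exact Finset.card_le_card (Finset.union_subset (Finset.filter_subset _ _)
    fun w hw => by simpa using hC w hw)

open Classical in
theorem card_sphere_succ_le (hG : G.Connected) (a : V) (n : ℕ) :
    (Finset.univ.filter fun v => G.dist a v = n + 1).card ≤
      ∑ v ∈ Finset.univ.filter fun v => G.dist a v = n, (upNeighbors G a v).card := by
  refine (Finset.card_le_card fun w hw => ?_).trans Finset.card_biUnion_le
  have hw : G.dist a w = n + 1 := by simpa using hw
  obtain ⟨v, hwv, hv⟩ := hG.exists_adj_dist_add_one (u := w) (v := a) (by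
    rintro rfl
    simp at hw)
  rw [SimpleGraph.dist_comm, SimpleGraph.dist_comm (u := w), hw] at hv
  have hv : G.dist a v = n := by omega
  simp only [upNeighbors, Finset.mem_biUnion, Finset.mem_filter, Finset.mem_univ, true_and,
    mem_neighborFinset]
  exact ⟨v, hv, hwv.symm, by omega⟩

open Classical in
theorem card_upNeighbors_le_two (hG : G.Connected) (hd : ∀ v, G.degree v = 3) {a v : V} {n : ℕ}
    (hv : G.dist a v = n + 1) : (upNeighbors G a v).card ≤ 2 := by
  obtain ⟨w, hvw, hw⟩ := exists_adj_dist_eq hG hv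
  have := card_upNeighbors_le (G := G) (a := a) (v := v) {w} (by simpa) (by simp; omega)
  rw [hd, Finset.card_singleton] at this
  omega

open Classical in
theorem branch_eq_univ (hd : ∀ v, G.degree v = 3) : branch G = Finset.univ := by
  simp [branch, hd]

theorem exists_guardable_five_of_far (hG : G.Connected) {u v : V} (h : 4 ≤ G.dist u v) :
    ∃ T, Guardable G T ∧ 5 ≤ T.card := by
  classical
  have hstep : ∀ w n, G.dist w v = n + 1 → ∃ w', G.dist w w' = 1 ∧ G.dist w' v = n := by
    intro w n hw
    obtain ⟨w', h1, h2⟩ := hG.exists_adj_dist_add_one (u := w) (v := v) (by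
      rintro rfl
      simp at hw)
    exact ⟨w', dist_eq_one_iff_adj.2 h1, by omega⟩
  obtain ⟨n, hn⟩ : ∃ n, G.dist u v = n + 1 + 1 + 1 + 1 := ⟨G.dist u v - 4, by omega⟩
  obtain ⟨c₁, h1, h1'⟩ := hstep _ _ hn
  obtain ⟨c₂, h2, h2'⟩ := hstep _ _ h1'
  obtain ⟨c₃, h3, h3'⟩ := hstep _ _ h2'
  have h4 := hG.dist_triangle (u := u) (v := c₁) (w := c₂)
  have h5 := hG.dist_triangle (u := u) (v := c₂) (w := v)
  have h6 := SimpleGraph.dist_comm (G := G) (u := c₂) (v := u)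
  have h7 := SimpleGraph.dist_comm (G := G) (u := c₂) (v := c₁)
  have h8 := SimpleGraph.dist_comm (G := G) (u := c₁) (v := u)
  have h9 := SimpleGraph.dist_comm (G := G) (u := v) (v := u)
  obtain ⟨T, hT, hyT, hwT⟩ := exists_guardable_spider hG c₂ ![u, v] ![c₁, c₃]
    (by simp [Fin.forall_fin_two]; omega)
    (by
      simp only [Fin.forall_fin_two, Matrix.cons_val_zero, Matrix.cons_val_one]
      refine ⟨⟨fun h => absurd rfl h, fun _ => ?_⟩, fun _ => ?_, fun h => absurd rfl h⟩ <;> omega)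
  simp only [Fin.forall_fin_two, Matrix.cons_val_zero, Matrix.cons_val_one] at hwT
  refine ⟨T, hT, ?_⟩
  have himg : ({n + 4, n + 3, n + 2, n + 1, 0} : Finset ℕ) ⊆ T.image fun w => G.dist w v := by
    simp only [Finset.insert_subset_iff, Finset.singleton_subset_iff, Finset.mem_image]
    exact ⟨⟨u, hwT.1.1, hn⟩, ⟨c₁, hwT.1.2, h1'⟩, ⟨c₂, hyT, h2'⟩, ⟨c₃, hwT.2.2, h3'⟩,
      ⟨v, hwT.2.1, SimpleGraph.dist_self⟩⟩
  refine le_trans ?_ ((Finset.card_le_card himg).trans Finset.card_image_le)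
  simp

open Classical in
theorem exists_guardable_five_of_upNeighbors (hG : G.Connected) (hd : ∀ v, G.degree v = 3)
    (hdist : ∀ u v, G.dist u v ≤ 3) {a : V} (ha : ∀ x y, G.Adj a x → G.Adj a y → ¬ G.Adj x y)
    {b : V} (hb : G.dist a b = 2) (hup : 2 ≤ (upNeighbors G a b).card) :
    ∃ T, Guardable G T ∧ 5 ≤ T.card := by
  obtain ⟨z, hbz, hz⟩ := exists_adj_dist_eq hG hb
  have hba := SimpleGraph.dist_comm (G := G) (u := b) (v := a)
  have haz := dist_eq_one_iff_adj.1 hz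
  have hbN : ∀ w, G.Adj b w → w = z ∨ G.dist a w = 3 := by
    intro w hw
    by_contra! hcon
    have hdw := dist_eq_one_iff_adj.2 hw
    have h1 := hG.dist_triangle (u := a) (v := b) (w := w)
    have h2 := card_upNeighbors_le (G := G) (a := a) (v := b) {w, z} (by simp [hw, hbz])
      (by simp; omega)
    rw [hd, Finset.card_pair hcon.1] at h2
    omega
  have hxb : ∀ x, G.Adj a x → x ≠ z → G.dist x b = 3 := by
    intro x hx hxz
    have hdx := dist_eq_one_iff_adj.2 hx
    refine le_antisymm (hdist x b) (not_lt.1 fun hlt => ?_)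
    have hne : G.dist x b ≠ 0 := by
      rw [Ne, hG.dist_eq_zero_iff]
      rintro rfl
      omega
    have h12 : G.dist x b = 1 ∨ G.dist x b = 1 + 1 := by omega
    rcases h12 with h | h
    · rcases hbN x (dist_eq_one_iff_adj.1 h).symm with h | h
      · exact hxz h
      · omega
    · obtain ⟨c, hbc, hc⟩ := exists_adj_dist_eq hG h
      rcases hbN c hbc with rfl | h
      · exact ha x c hx haz (dist_eq_one_iff_adj.1 hc)
      · have := hG.dist_triangle (u := a) (v := x) (w := c)
        omega
  obtain ⟨x, y, hxy, hxyz⟩ : ∃ x y, x ≠ y ∧ (G.neighborFinset a).erase z = {x, y} := by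
    rw [← Finset.card_eq_two, Finset.card_erase_of_mem (by simpa using haz),
      card_neighborFinset_eq_degree, hd]
  have hmem : ∀ w, w ∈ ({x, y} : Finset V) → w ≠ z ∧ G.Adj a w := by
    intro w hw
    rw [← hxyz] at hw
    simpa using hw
  obtain ⟨hxz, hax⟩ := hmem x (by simp)
  obtain ⟨hyz, hay⟩ := hmem y (by simp)
  have hdx := dist_eq_one_iff_adj.2 hax
  have hdy := dist_eq_one_iff_adj.2 hay
  have hdz := dist_eq_one_iff_adj.2 hbz
  have hdxy : G.dist x y = 2 := by
    have h1 := hG.dist_triangle (u := x) (v := a) (w := y)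
    have h2 : G.dist x y ≠ 1 := fun h => ha x y hax hay (dist_eq_one_iff_adj.1 h)
    have h3 := hG.pos_dist_of_ne hxy
    rw [SimpleGraph.dist_comm (u := x) (v := a)] at h1
    omega
  have hxb3 := hxb x hax hxz
  have hyb3 := hxb y hay hyz
  obtain ⟨T, hT, hyT, hwT⟩ := exists_guardable_spider hG a ![x, y, b] ![x, y, z]
    (by
      have := SimpleGraph.dist_comm (G := G) (u := b) (v := z)
      intro i
      fin_cases i <;> simp
      omega)
    (by
      have h1 := SimpleGraph.dist_comm (G := G) (u := x) (v := y)
      have h2 := SimpleGraph.dist_comm (G := G) (u := x) (v := b)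
      have h3 := SimpleGraph.dist_comm (G := G) (u := y) (v := b)
      intro i j hij
      fin_cases i <;> fin_cases j <;> simp at hij ⊢ <;> omega)
  have hwT := And.intro (hwT 0).1 (And.intro (hwT 1).1 (hwT 2))
  simp only [Matrix.cons_val] at hwT
  refine ⟨T, hT, ?_⟩
  have hsub : insert a (insert b {x, y, z}) ⊆ T := by
    simp [Finset.insert_subset_iff, hyT, hwT]
  refine le_trans ?_ (Finset.card_le_card hsub)
  have hbne : ∀ w, G.Adj a w → b ≠ w := by
    rintro w hw rfl
    have := dist_eq_one_iff_adj.2 hw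
    omega
  have hab : a ≠ b := by
    rintro rfl
    simp at hb
  rw [Finset.card_insert_of_notMem (by simp [hab, hax.ne, hay.ne, haz.ne]),
    Finset.card_insert_of_notMem (by simp [hbne, hax, hay, haz]),
    Finset.card_eq_three.2 ⟨x, y, z, hxy, hxz, hyz, rfl⟩]

open Classical in
theorem exists_guardable_five (hG : G.Connected) (hd : ∀ v, G.degree v = 3)
    (hV : 17 ≤ Fintype.card V) : ∃ T, Guardable G T ∧ 5 ≤ T.card := by
  by_contra hcon
  have hdist : ∀ u v, G.dist u v ≤ 3 := by
    intro u v
    by_contra! h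
    exact hcon (exists_guardable_five_of_far hG h)
  obtain ⟨a⟩ := hG.nonempty
  set N : ℕ → Finset V := fun n => Finset.univ.filter fun v => G.dist a v = n with hN
  have hN0 : (N 0).card = 1 := by
    rw [Finset.card_eq_one]
    refine ⟨a, ?_⟩
    ext v
    rw [Finset.mem_singleton, ← hG.dist_eq_zero_iff, SimpleGraph.dist_comm]
    simp [hN]
  have hN1 : (N 1).card = 3 := by
    rw [← hd a, ← card_neighborFinset_eq_degree]
    congr 1
    ext v
    simp [hN, dist_eq_one_iff_adj]
  have htot : Fintype.card V ≤ (N 0).card + (N 1).card + (N 2).card + (N 3).card := by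
    rw [← Finset.card_univ]
    refine le_trans (Finset.card_le_card (t := N 0 ∪ N 1 ∪ N 2 ∪ N 3) fun v _ => ?_) ?_
    · have := hdist a v
      simp only [hN, Finset.mem_union, Finset.mem_filter, Finset.mem_univ, true_and]
      omega
    · refine (Finset.card_union_le _ _).trans (Nat.add_le_add_right ?_ _)
      exact (Finset.card_union_le _ _).trans (Nat.add_le_add_right (Finset.card_union_le _ _) _)
  have h2 : (N 2).card ≤ ∑ v ∈ N 1, (upNeighbors G a v).card := card_sphere_succ_le hG a 1
  have h3 : (N 3).card ≤ ∑ v ∈ N 2, (upNeighbors G a v).card := card_sphere_succ_le hG a 2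
  have hup : ∀ n, ∀ v ∈ N (n + 1), (upNeighbors G a v).card ≤ 2 := fun n v hv =>
    card_upNeighbors_le_two hG hd (n := n) (by simpa [hN] using hv)
  by_cases ha : ∃ x y, G.Adj a x ∧ G.Adj a y ∧ G.Adj x y
  · obtain ⟨x, y, hx, hy, hxy⟩ := ha
    have hdx := dist_eq_one_iff_adj.2 hx
    have hdy := dist_eq_one_iff_adj.2 hy
    have hle : ∀ x y, G.Adj a x → G.Adj a y → G.Adj x y → (upNeighbors G a x).card ≤ 1 := by
      intro x y hx hy hxy
      have h := card_upNeighbors_le (G := G) (a := a) (v := x) {a, y} (by simp [hx.symm, hxy])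
        (by simp [dist_eq_one_iff_adj.2 hx, dist_eq_one_iff_adj.2 hy])
      rw [hd, Finset.card_pair hy.ne] at h
      omega
    have hxN : x ∈ N 1 := by simpa [hN] using hx
    have hyN : y ∈ (N 1).erase x := by simpa [hN, hxy.ne'] using hy
    have h4 := Finset.add_sum_erase _ (fun v => (upNeighbors G a v).card) hxN
    have h5 := Finset.add_sum_erase _ (fun v => (upNeighbors G a v).card) hyN
    have h6 := Finset.sum_le_card_nsmul (((N 1).erase x).erase y)
      (fun v => (upNeighbors G a v).card) 2
      fun v hv => hup 0 v (Finset.mem_of_mem_erase (Finset.mem_of_mem_erase hv))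
    rw [Finset.card_erase_of_mem hyN, Finset.card_erase_of_mem hxN, hN1] at h6
    have h7 := Finset.sum_le_card_nsmul (N 2) (fun v => (upNeighbors G a v).card) 2 (hup 1)
    have h8 := hle x y hx hy hxy
    have h9 := hle y x hy hx hxy.symm
    simp only [smul_eq_mul] at *
    omega
  · push Not at ha
    have h6 := Finset.sum_le_card_nsmul (N 1) (fun v => (upNeighbors G a v).card) 2 (hup 0)
    have h7 := Finset.sum_le_card_nsmul (N 2) (fun v => (upNeighbors G a v).card) 1 fun v hv => by
      by_contra! h
      exact hcon (exists_guardable_five_of_upNeighbors hG hd hdist ha (b := v)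
        (by simpa [hN] using hv) h)
    simp only [smul_eq_mul] at *
    omega

open Classical in
theorem hasGuard_five (hG : G.Connected) (hd : ∀ v, G.degree v = 3)
    (hV : 17 ≤ Fintype.card V) : HasGuard G 5 := by
  obtain ⟨T, hT, hT5⟩ := exists_guardable_five hG hd hV
  exact ⟨T, T, hT, by simp [branch_eq_univ hd], subset_rfl, hT5⟩

end Cubic

open Classical in
theorem copsWin_two_of_excess_le (V : Type u) [Fintype V] (G : SimpleGraph V) (hG : G.Connected)
    (hd : ∀ v, G.degree v ≤ 3) (he : excess G Finset.univ ≤ 8) : CopsWin G 2 := by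
  refine copsWin_of_guardable (k := 1) (c := -1) le_rfl copsWin_one_of_excess_neg
    (fun W _ H hH hdeg he _ => ?_) V G hG hd he le_rfl
  rw [excess_univ_eq_card_branch hdeg] at he
  have hd' := fun v => (hdeg v).2
  obtain h | h | h | h : (branch H).card ≤ 1 ∨ (2 ≤ (branch H).card ∧ (branch H).card ≤ 5) ∨
      (5 ≤ (branch H).card ∧ (branch H).card ≤ 7) ∨ (branch H).card = 8 := by omega
  · exact (hasGuard_zero hH).exists_excess_compl_le hdeg (by omega)
  · exact (hasGuard_two hH h.1).exists_excess_compl_le hdeg (by omega)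
  · exact (hasGuard_three hH hd' h.1).exists_excess_compl_le hdeg (by omega)
  · exact (hasGuard_four hH hd' (Or.inl h)).exists_excess_compl_le hdeg (by omega)

open Classical in
theorem copsWin_three_of_card_le (V : Type u) [Fintype V] (G : SimpleGraph V) (hG : G.Connected)
    (hd : ∀ v, G.degree v ≤ 3) (hn : Fintype.card V ≤ 20) : CopsWin G 3 := by
  have he : excess G Finset.univ ≤ 20 := by
    rw [excess_univ]
    have : ∑ v, ((G.degree v : ℤ) - 2) ≤ ∑ _v : V, 1 := Finset.sum_le_sum fun v _ => by
      have := hd v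
      omega
    simp only [Finset.sum_const, Finset.card_univ, nsmul_eq_mul, mul_one] at this
    omega
  refine copsWin_of_guardable (k := 2) (c := 8) (by decide) copsWin_two_of_excess_le
    (fun W _ H hH hdeg he hn => ?_) V G hG hd he hn
  have heven := even_excess_univ (G := H)
  rw [excess_univ_eq_card_branch hdeg] at he heven
  rw [Int.even_iff] at heven
  have hd' := fun v => (hdeg v).2
  obtain h | h | h | h : (branch H).card ≤ 10 ∨ (2 ≤ (branch H).card ∧ (branch H).card ≤ 14) ∨
      (14 ≤ (branch H).card ∧ (branch H).card ≤ 18) ∨ (branch H).card = 20 := by omega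
  · exact (hasGuard_zero hH).exists_excess_compl_le hdeg (by omega)
  · exact (hasGuard_two hH h.1).exists_excess_compl_le hdeg (by omega)
  · exact (hasGuard_four hH hd' (Or.inr h.1)).exists_excess_compl_le hdeg (by omega)
  · have hcard := (branch H).card_le_univ
    have huniv : branch H = Finset.univ := by
      rw [← Finset.card_eq_iff_eq_univ]
      omega
    have hd3 : ∀ v, H.degree v = 3 := fun v => le_antisymm (hd' v) <| by
      have : v ∈ branch H := huniv ▸ Finset.mem_univ v
      simpa [branch] using this
    exact (hasGuard_five hH hd3 (by omega)).exists_excess_compl_le hdeg (by omega)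

/-- If `G` is a finite connected graph on at most 20 vertices with
maximum degree at most 3, then `c(G) ≤ 3`. -/
theorem copNumber_le_three_subcubic {V : Type*} [Fintype V] (G : SimpleGraph V)
    [DecidableRel G.Adj] (hG : G.Connected) (hn : Fintype.card V ≤ 20)
    (hΔ : G.maxDegree ≤ 3) :
    copNumber G ≤ 3 := by
  classical
  obtain rfl : ‹DecidableRel G.Adj› = fun _ _ => Classical.propDecidable _ :=
    Subsingleton.elim _ _
  refine csSup_le' ?_
  rintro _ ⟨C, rfl⟩
  refine Nat.sInf_le (copsWin_three_of_card_le _ _ C.connected_toSimpleGraph (fun v => ?_) ?_)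
  · exact (degree_induce_le v).trans ((G.degree_le_maxDegree (v : V)).trans hΔ)
  · exact (Fintype.card_subtype_le _).trans hn
end
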